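/- arXiv:math/0109118 — 2 statements merged into one kernel-verified Lean document; each statement's English description precedes it below -/
import Mathlib

section
/- Let R be an associative unital ring and D(R) the unbounded derived category of left R-modules. Every triangulated subcategory of D(R) that is closed under small coproducts and contains the object R (the complex with R in degree 0 and zero elsewhere) is all of D(R): every object of D(R) lies in (i.e. is isomorphic to an object of) the subcategory. -/
open CategoryTheory Limits Pretriangulated

universe u

universe v w

namespace CategoryTheory.ObjectProperty

open Opposite

section

variable {C : Type*} [Category* C] [HasZeroObject C] [HasShift C ℤ] [Preadditive C]
  [∀ n : ℤ, (shiftFunctor C n).Additive] [Pretriangulated C]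

/-- If the cones of `g` and of `f ≫ g` lie in a triangulated subcategory, so does the cone of
`f`. -/
lemma trW_of_trW_comp [IsTriangulated C] (P : ObjectProperty C) [P.IsTriangulated]
    [P.IsClosedUnderIsomorphisms] {X Y Z : C} (f : X ⟶ Y) (g : Y ⟶ Z) (hg : P.trW g)
    (hfg : P.trW (f ≫ g)) : P.trW f := by
  obtain ⟨_, _, _, h₁₂⟩ := distinguished_cocone_triangle f
  obtain ⟨_, _, _, h₂₃, h₂⟩ := hg
  obtain ⟨_, _, _, h₁₃, h₃⟩ := hfg
  have := (Triangulated.someOctahedron rfl h₁₂ h₂₃ h₁₃).mem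
  exact trW.mk _ h₁₂ (P.ext_of_isTriangulatedClosed₁ _ this h₃ h₂)

/-- If a triangulated subcategory is closed under coproducts indexed by `J`, then a coproduct
indexed by `J` of morphisms whose cones lie in it has its cone in it. -/
lemma trW_sigmaMap (P : ObjectProperty C) [P.IsTriangulated] [P.IsClosedUnderIsomorphisms]
    (J : Type*) [HasCoproductsOfShape J C] [P.IsClosedUnderColimitsOfShape (Discrete J)]
    {X Y : J → C} (f : ∀ j, X j ⟶ Y j) (hf : ∀ j, P.trW (f j)) :
    P.trW (Limits.Sigma.map f) := by
  have : P.op.IsClosedUnderLimitsOfShape (Discrete J) :=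
    .of_equivalence (Discrete.opposite J)
  apply P.trW_of_op
  choose Z g h hT hZ using fun j ↦ (P.trW_op_iff (f := (f j).op)).2 (hf j)
  have H : P.op.trW (Limits.Pi.map fun j ↦ (f j).op) :=
    trW.mk _ (productTriangle_distinguished (fun j ↦ Triangle.mk (f j).op (g j) (h j)) hT)
      (P.op.prop_pi _ hZ)
  refine (P.op.trW.arrow_mk_iso_iff (Arrow.isoMk (opCoproductIsoProduct Y)
    (opCoproductIsoProduct X) ?_)).2 H
  dsimp
  ext j
  simp [← op_comp, opCoproductIsoProduct_hom_comp_π]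

end

section

variable {C : Type*} [Category* C] [HasCoproductsOfShape ℕ C]

/-- The endomorphism of the coproduct of a sequence `X 0 ⟶ X 1 ⟶ ⋯` which is given by the
transition maps. -/
noncomputable def sigmaShift {X : ℕ → C} (f : ∀ n, X n ⟶ X (n + 1)) : ∐ X ⟶ ∐ X :=
  Limits.Sigma.desc fun n ↦ f n ≫ Sigma.ι X (n + 1)

@[simp]
lemma ι_sigmaShift {X : ℕ → C} (f : ∀ n, X n ⟶ X (n + 1)) (n : ℕ) :
    Sigma.ι X n ≫ sigmaShift f = f n ≫ Sigma.ι X (n + 1) := by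
  simp [sigmaShift]

end

section

variable {C : Type*} [Category* C] [HasZeroObject C] [HasShift C ℤ] [Preadditive C]
  [∀ n : ℤ, (shiftFunctor C n).Additive] [Pretriangulated C] [HasCoproductsOfShape ℕ C]

/-- The homotopy colimit of the constant sequence at `X` is `X`. -/
lemma distinguished_one_sub_sigmaShift (X : C) :
    ∃ h, Triangle.mk (𝟙 _ - sigmaShift (X := fun _ ↦ X) fun _ ↦ 𝟙 X)
      (Limits.Sigma.desc fun _ ↦ 𝟙 X) h ∈ distTriang C := by
  let A := ∐ fun _ : ℕ ↦ X
  let ι (n : ℕ) : X ⟶ A := Sigma.ι (fun _ : ℕ ↦ X) n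
  let s : A ⟶ A := 𝟙 _ - sigmaShift (X := fun _ ↦ X) fun _ ↦ 𝟙 X
  let p : A ⟶ X := Limits.Sigma.desc fun _ ↦ 𝟙 X
  let r : A ⟶ A := Limits.Sigma.desc fun n ↦ - ∑ k ∈ Finset.range n, ι k
  have hs (n : ℕ) : ι n ≫ s = ι n - ι (n + 1) := by
    refine (Preadditive.comp_sub ..).trans ?_
    congr 1
    · exact Category.comp_id _
    · simp [ι]
  have hp (n : ℕ) : ι n ≫ p = 𝟙 X := by simp [ι, p]
  have hr (n : ℕ) : ι n ≫ r = - ∑ k ∈ Finset.range n, ι k := by simp [ι, r]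
  have sr : s ≫ r = 𝟙 A := by
    refine Limits.Sigma.hom_ext _ _ fun n ↦ ?_
    change ι n ≫ _ = ι n ≫ _
    rw [reassoc_of% hs, Preadditive.sub_comp, hr, hr, Finset.sum_range_succ]
    simp
  have sp : s ≫ p = 0 := by
    refine Limits.Sigma.hom_ext _ _ fun n ↦ ?_
    change ι n ≫ _ = ι n ≫ _
    rw [reassoc_of% hs, Preadditive.sub_comp, hp, hp]
    simp
  have ir : ι 0 ≫ r = 0 := by simp [hr]
  have tot : r ≫ s + p ≫ ι 0 = 𝟙 A := by
    refine Limits.Sigma.hom_ext _ _ fun n ↦ ?_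
    change ι n ≫ _ = ι n ≫ _
    rw [Preadditive.comp_add, reassoc_of% hr, reassoc_of% hp, Preadditive.neg_comp,
      Preadditive.sum_comp]
    simp only [hs, Finset.sum_range_sub']
    simp
  let b : BinaryBicone A X :=
    { pt := A, inl := s, inr := ι 0, fst := r, snd := p, inl_fst := sr, inl_snd := sp,
      inr_fst := ir, inr_snd := hp 0 }
  have hb : b.IsBilimit := isBinaryBilimitOfTotal b tot
  let e : A ≅ A ⊞ X := biprod.uniqueUpToIso _ _ hb
  refine ⟨0, isomorphic_distinguished _ (binaryBiproductTriangle_distinguished A X) _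
    (Triangle.isoMk _ _ (Iso.refl _) e (Iso.refl _) ?_ ?_ ?_)⟩
  · change s ≫ e.hom = 𝟙 _ ≫ biprod.inl
    refine biprod.hom_ext _ _ ?_ ?_
    · simpa [e, b] using sr
    · simpa [e, b] using sp
  · change p ≫ 𝟙 _ = e.hom ≫ biprod.snd
    simp [e, b]
  · exact zero_comp.trans comp_zero.symm

/-- Let `X 0 ⟶ X 1 ⟶ ⋯` be a sequence of morphisms whose cones lie in a triangulated
subcategory closed under countable coproducts. If the homotopy colimit of the sequence
vanishes, then `X 0` lies in the subcategory. -/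
lemma prop_of_isIso_one_sub_sigmaShift [IsTriangulated C] (P : ObjectProperty C)
    [P.IsTriangulated] [P.IsClosedUnderIsomorphisms]
    [P.IsClosedUnderColimitsOfShape (Discrete ℕ)]
    {X : ℕ → C} (f : ∀ n, X n ⟶ X (n + 1)) (hf : ∀ n, P.trW (f n))
    [IsIso (𝟙 _ - sigmaShift f)] : P (X 0) := by
  let g (n : ℕ) : X 0 ⟶ X n := Nat.rec (𝟙 _) (fun n g ↦ g ≫ f n) n
  have g_succ (n : ℕ) : g (n + 1) = g n ≫ f n := rfl
  have hg (n : ℕ) : P.trW (g n) := by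
    induction n with
    | zero => exact MorphismProperty.id_mem _ _
    | succ n hn => exact MorphismProperty.comp_mem _ _ _ hn (hf n)
  have comm : (𝟙 _ - sigmaShift (X := fun _ ↦ X 0) fun _ ↦ 𝟙 (X 0)) ≫ Limits.Sigma.map g =
      Limits.Sigma.map g ≫ (𝟙 _ - sigmaShift f) := by
    ext n
    simp [g_succ, reassoc_of% ι_sigmaShift]
  obtain ⟨h, hT⟩ := distinguished_one_sub_sigmaShift (X 0)
  have hi := P.trW_sigmaMap ℕ g hg
  refine (P.trW_iff_of_distinguished _ hT).1 (P.trW_of_trW_comp _ _ hi ?_)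
  exact comm ▸ P.trW.comp_mem _ _ hi (P.trW_of_isIso _)

end

end CategoryTheory.ObjectProperty

namespace DerivedCategory

lemma exists_inr_comp_of_homotopy_zero {C : Type*} [Category* C] [Preadditive C]
    [HasBinaryBiproducts C] {K L : CochainComplex C ℤ} (φ : K ⟶ L)
    (h : Homotopy φ 0) :
    ∃ ψ, CochainComplex.mappingCone.inr (𝟙 K) ≫ ψ = φ :=
  ⟨CochainComplex.mappingCone.desc (𝟙 K) (CochainComplex.HomComplex.Cochain.ofHomotopy h) φ
    (by simp [CochainComplex.HomComplex.δ_ofHomotopy]), by simp⟩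

section

variable {C : Type*} [Category* C] [Abelian C] [HasDerivedCategory C]

lemma exists_homotopy_zero_of_Q_map_eq_zero {K L : CochainComplex C ℤ} (φ : K ⟶ L)
    (hφ : Q.map φ = 0) :
    ∃ (K' : CochainComplex C ℤ) (t : K' ⟶ K), QuasiIso t ∧ Nonempty (Homotopy (t ≫ φ) 0) := by
  have h : Qh.map ((HomotopyCategory.quotient C _).map φ) = Qh.map 0 := by
    rw [← cancel_mono ((quotientCompQhIso C).hom.app L), quotientCompQhIso_hom_naturality, hφ]
    simp
  obtain ⟨K', t, ht, fac⟩ :=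
    (MorphismProperty.map_eq_iff_precomp Qh (HomotopyCategory.quasiIso C _) _ _).1 h
  obtain ⟨K', rfl⟩ := HomotopyCategory.quotient_obj_surjective K'
  obtain ⟨t, rfl⟩ := (HomotopyCategory.quotient _ _).map_surjective t
  rw [← isIso_Qh_map_iff] at ht
  refine ⟨K', t, (isIso_Q_map_iff_quasiIso C t).1 ht, ⟨HomotopyCategory.homotopyOfEq _ _ ?_⟩⟩
  simpa using fac

lemma isZero_Q_obj_of_homotopy_id_zero {K : CochainComplex C ℤ} (h : Homotopy (𝟙 K) 0) :
    IsZero (Q.obj K) := by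
  rw [IsZero.iff_id_eq_zero, ← Q.map_id, Q_map_eq_of_homotopy C h, Q.map_zero]

variable {J : Type*} [HasCoproductsOfShape J (CochainComplex C ℤ)]
  [(HomologicalComplex.quasiIso C (ComplexShape.up ℤ)).IsStableUnderCoproductsOfShape J]

lemma isIso_Q_map_sigmaMap {K L : J → CochainComplex C ℤ} (s : ∀ j, K j ⟶ L j)
    (hs : ∀ j, IsIso (Q.map (s j))) : IsIso (Q.map (Limits.Sigma.map s)) := by
  simp only [isIso_Q_map_iff_quasiIso] at hs ⊢
  exact MorphismProperty.colimMap (W := HomologicalComplex.quasiIso C (ComplexShape.up ℤ)) _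
    fun j ↦ hs j.as

lemma isZero_Q_obj_sigma (K : J → CochainComplex C ℤ) (hK : ∀ j, IsZero (Q.obj (K j))) :
    IsZero (Q.obj (∐ K)) := by
  have h := isIso_Q_map_sigmaMap (fun j ↦ (0 : K j ⟶ K j)) fun j ↦
    ⟨0, (hK j).eq_of_src _ _, (hK j).eq_of_src _ _⟩
  have h0 : Limits.Sigma.map (fun j ↦ (0 : K j ⟶ K j)) = 0 := by
    ext1
    simp
  rw [h0, Q.map_zero] at h
  rw [IsZero.iff_id_eq_zero, ← cancel_epi (0 : Q.obj (∐ K) ⟶ Q.obj (∐ K))]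
  simp

lemma Q_map_desc_eq_zero {K : J → CochainComplex C ℤ} {L : CochainComplex C ℤ}
    (g : ∀ j, K j ⟶ L) (hg : ∀ j, Q.map (g j) = 0) : Q.map (Limits.Sigma.desc g) = 0 := by
  choose K' t ht h using fun j ↦ exists_homotopy_zero_of_Q_map_eq_zero (g j) (hg j)
  choose ψ hψ using fun j ↦ exists_inr_comp_of_homotopy_zero _ (h j).some
  have : IsIso (Q.map (Limits.Sigma.map t)) :=
    isIso_Q_map_sigmaMap t fun j ↦ (isIso_Q_map_iff_quasiIso C _).2 (ht j)
  have fac : Limits.Sigma.map t ≫ Limits.Sigma.desc g =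
      Limits.Sigma.map (fun j ↦ CochainComplex.mappingCone.inr (𝟙 (K' j))) ≫
        Limits.Sigma.desc ψ := by
    refine Limits.Sigma.hom_ext _ _ fun j ↦ ?_
    simp [hψ]
  have hz : IsZero (Q.obj (∐ fun j ↦ CochainComplex.mappingCone (𝟙 (K' j)))) :=
    isZero_Q_obj_sigma _ fun j ↦ isZero_Q_obj_of_homotopy_id_zero
      (CochainComplex.mappingCone.homotopyToZeroOfId _)
  rw [← cancel_epi (Q.map (Limits.Sigma.map t)), ← Q.map_comp, fac, Q.map_comp, comp_zero,
    hz.eq_of_src (Q.map (Limits.Sigma.desc ψ)) 0, comp_zero]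

/-- Morphisms in the derived category from a coproduct of complexes are determined by their
restrictions to the summands. -/
lemma hom_ext_Q_sigma {K : J → CochainComplex C ℤ} {X : DerivedCategory C}
    (f g : Q.obj (∐ K) ⟶ X) (h : ∀ j, Q.map (Sigma.ι K j) ≫ f = Q.map (Sigma.ι K j) ≫ g) :
    f = g := by
  obtain ⟨a, ha⟩ : ∃ a, a = (f - g) ≫ (Q.objObjPreimageIso X).inv := ⟨_, rfl⟩
  have hz (j : J) : Q.map (Sigma.ι K j) ≫ a = 0 := by
    rw [ha, ← Category.assoc, Preadditive.comp_sub, h, sub_self, zero_comp]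
  rw [← sub_eq_zero, ← cancel_mono (Q.objObjPreimageIso X).inv, zero_comp, ← ha]
  obtain ⟨Y, φ, s, hs, rfl⟩ := left_fac a
  have : Q.map φ = 0 := by
    have : φ = Limits.Sigma.desc fun j ↦ Sigma.ι K j ≫ φ := by
      ext1
      simp
    rw [this]
    refine Q_map_desc_eq_zero _ fun j ↦ ?_
    rw [Q.map_comp, ← cancel_mono (inv (Q.map s)), Category.assoc, hz, zero_comp]
  rw [this, zero_comp]

lemma exists_desc_Q_sigma {K : J → CochainComplex C ℤ} {X : DerivedCategory C}
    (f : ∀ j, Q.obj (K j) ⟶ X) : ∃ g, ∀ j, Q.map (Sigma.ι K j) ≫ g = f j := by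
  choose K' s hs φ h using fun j ↦ right_fac (f j ≫ (Q.objObjPreimageIso X).inv)
  have := isIso_Q_map_sigmaMap s hs
  refine ⟨inv (Q.map (Limits.Sigma.map s)) ≫ Q.map (Limits.Sigma.desc φ) ≫
    (Q.objObjPreimageIso X).hom, fun j ↦ ?_⟩
  have := hs j
  rw [← cancel_epi (Q.map (s j)), ← Q.map_comp_assoc]
  have e : s j ≫ Sigma.ι K j = Sigma.ι K' j ≫ Limits.Sigma.map s := by simp
  rw [e, Q.map_comp_assoc, IsIso.hom_inv_id_assoc, ← Q.map_comp_assoc, Sigma.ι_desc]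
  have := h j
  rw [IsIso.eq_inv_comp, ← Category.assoc, Iso.comp_inv_eq] at this
  exact this.symm

instance preservesColimitsOfShape_Q : PreservesColimitsOfShape (Discrete J) (Q (C := C)) :=
  have (K : J → CochainComplex C ℤ) : PreservesColimit (Discrete.functor K) Q := by
    refine preservesColimit_of_preserves_colimit_cocone (coproductIsCoproduct K) ?_
    refine (isColimitMapCoconeCofanMkEquiv Q K _).2 ?_
    choose d hd using fun (s : Cofan fun j ↦ Q.obj (K j)) ↦ exists_desc_Q_sigma s.inj
    exact Cofan.IsColimit.mk _ d (fun s j ↦ hd s j)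
      fun s m hm ↦ hom_ext_Q_sigma _ _ fun j ↦ (hm j).trans (hd s j).symm
  preservesColimitsOfShape_of_discrete _

variable (C J) in
lemma hasCoproductsOfShape : HasCoproductsOfShape J (DerivedCategory C) where
  has_colimit F := by
    let K (j : J) : CochainComplex C ℤ := Q.objPreimage (F.obj ⟨j⟩)
    exact hasColimit_of_iso (F := Discrete.functor K ⋙ Q)
      (Discrete.natIso fun j ↦ (Q.objObjPreimageIso (F.obj j)).symm)

end

end DerivedCategory

namespace ModuleCat

section

variable {R : Type u} [Ring R] {J : Type w} [HasCoproductsOfShape J (ModuleCat.{v} R)]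
  {ι : Type*} {c : ComplexShape ι} (K : J → HomologicalComplex (ModuleCat.{v} R) c)

open Classical in
lemma exists_finset_sum_π_ι_f_apply_eq (i : ι) (z : (∐ K).X i) :
    ∃ F : Finset J, ∀ F', F ⊆ F' →
      ((∑ j ∈ F', Limits.Sigma.π K j ≫ Sigma.ι K j).f i).hom z = z := by
  let N : Submodule R ((∐ K).X i) :=
    { carrier := {z | ∃ F : Finset J, ∀ F', F ⊆ F' →
        ((∑ j ∈ F', Limits.Sigma.π K j ≫ Sigma.ι K j).f i).hom z = z}
      zero_mem' := ⟨∅, fun _ _ ↦ map_zero _⟩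
      add_mem' := by
        rintro x y ⟨F, hF⟩ ⟨G, hG⟩
        refine ⟨F ∪ G, fun F' h ↦ ?_⟩
        rw [map_add, hF _ (Finset.union_subset_left h), hG _ (Finset.union_subset_right h)]
      smul_mem' := by
        rintro r x ⟨F, hF⟩
        exact ⟨F, fun F' h ↦ by rw [map_smul, hF _ h]⟩ }
  have hι (j : J) (y : (K j).X i) : ((Sigma.ι K j).f i).hom y ∈ N := by
    refine ⟨{j}, fun F' hF' ↦ ?_⟩
    have : Sigma.ι K j ≫ ∑ j ∈ F', Limits.Sigma.π K j ≫ Sigma.ι K j = Sigma.ι K j := by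
      rw [Preadditive.comp_sum, Finset.sum_eq_single_of_mem j (by simpa using hF')]
      · simp
      · intro k _ hk
        rw [Sigma.ι_π_of_ne_assoc _ hk.symm, zero_comp]
    exact congr($(this).f i |>.hom y)
  have hN : ModuleCat.ofHom N.mkQ = 0 :=
    (isColimitCofanMkObjOfIsColimit (HomologicalComplex.eval _ _ i) K _
      (coproductIsCoproduct K)).hom_ext fun ⟨j⟩ ↦ by
        ext y
        exact (Submodule.Quotient.mk_eq_zero _).2 (hι j y)
  exact (Submodule.Quotient.mk_eq_zero N).1 congr($(hN).hom z)

open Classical in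
lemma exists_homologyMap_sum_π_ι_apply_eq (i : ι) (x : (∐ K).homology i) :
    ∃ F : Finset J, (HomologicalComplex.homologyMap
      (∑ j ∈ F, Limits.Sigma.π K j ≫ Sigma.ι K j) i).hom x = x := by
  obtain ⟨z, rfl⟩ := (ModuleCat.epi_iff_surjective ((∐ K).homologyπ i)).1 inferInstance x
  obtain ⟨F, hF⟩ := exists_finset_sum_π_ι_f_apply_eq K i (((∐ K).iCycles i).hom z)
  refine ⟨F, ?_⟩
  have h : (HomologicalComplex.cyclesMap
      (∑ j ∈ F, Limits.Sigma.π K j ≫ Sigma.ι K j) i).hom z = z := by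
    refine (ModuleCat.mono_iff_injective ((∐ K).iCycles i)).1 inferInstance ?_
    refine Eq.trans ?_ (hF F subset_rfl)
    exact congr(Hom.hom $(HomologicalComplex.cyclesMap_i
      (∑ j ∈ F, Limits.Sigma.π K j ≫ Sigma.ι K j) i) z)
  refine Eq.trans congr(Hom.hom $(HomologicalComplex.homologyπ_naturality
    (∑ j ∈ F, Limits.Sigma.π K j ≫ Sigma.ι K j) i) z) ?_
  exact congrArg ((∐ K).homologyπ i).hom h

open Classical in
lemma exists_eq_sum_homologyMap_ι (i : ι) (x : (∐ K).homology i) :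
    ∃ F : Finset J, x = ∑ j ∈ F, (HomologicalComplex.homologyMap (Sigma.ι K j) i).hom
      ((HomologicalComplex.homologyMap (Limits.Sigma.π K j) i).hom x) := by
  obtain ⟨F, hF⟩ := exists_homologyMap_sum_π_ι_apply_eq K i x
  refine ⟨F, hF.symm.trans ?_⟩
  have h : HomologicalComplex.homologyMap (∑ j ∈ F, Limits.Sigma.π K j ≫ Sigma.ι K j) i =
      ∑ j ∈ F, HomologicalComplex.homologyMap (Limits.Sigma.π K j) i ≫
        HomologicalComplex.homologyMap (Sigma.ι K j) i := by
    refine ((HomologicalComplex.homologyFunctor _ c i).map_sum _ _).trans ?_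
    simp [HomologicalComplex.homologyMap_comp]
    rfl
  rw [h]
  simp [ModuleCat.hom_sum]

variable {K} in
lemma homology_sigma_hom_ext (i : ι) {M : ModuleCat.{v} R} {f g : (∐ K).homology i ⟶ M}
    (h : ∀ j, HomologicalComplex.homologyMap (Sigma.ι K j) i ≫ f =
      HomologicalComplex.homologyMap (Sigma.ι K j) i ≫ g) : f = g := by
  classical
  ext x
  obtain ⟨F, hF⟩ := exists_eq_sum_homologyMap_ι K i x
  rw [hF, map_sum, map_sum]
  exact Finset.sum_congr rfl fun j _ ↦ congr($(h j).hom _)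

instance quasiIso_isStableUnderCoproductsOfShape :
    (HomologicalComplex.quasiIso (ModuleCat.{v} R) c).IsStableUnderCoproductsOfShape J := by
  classical
  refine MorphismProperty.IsStableUnderCoproductsOfShape.mk _ _ fun K L _ _ f hf ↦ ?_
  simp only [HomologicalComplex.mem_quasiIso_iff] at hf ⊢
  rw [quasiIso_iff]
  intro i
  rw [quasiIsoAt_iff_isIso_homologyMap, ConcreteCategory.isIso_iff_bijective]
  have hf' (j : J) := (ConcreteCategory.isIso_iff_bijective
    (HomologicalComplex.homologyMap (f j) i)).1 inferInstance
  constructor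
  · rw [injective_iff_map_eq_zero]
    intro x hx
    obtain ⟨F, hF⟩ := exists_eq_sum_homologyMap_ι K i x
    rw [hF]
    refine Finset.sum_eq_zero fun j _ ↦ ?_
    have comm : Limits.Sigma.π K j ≫ f j = Limits.Sigma.map f ≫ Limits.Sigma.π L j := by
      refine Limits.Sigma.hom_ext _ _ fun k ↦ ?_
      obtain rfl | hk := eq_or_ne k j
      · simp
      · simp [Sigma.ι_π_of_ne_assoc _ hk, Sigma.ι_π_of_ne _ hk]
    have : HomologicalComplex.homologyMap (Limits.Sigma.π K j) i x = 0 := by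
      apply (hf' j).1
      have := congr(HomologicalComplex.homologyMap $comm i)
      simp only [HomologicalComplex.homologyMap_comp] at this
      refine Eq.trans congr($(this).hom x) ?_
      exact (congrArg (HomologicalComplex.homologyMap (Limits.Sigma.π L j) i).hom hx).trans
        ((map_zero _).trans (map_zero _).symm)
    exact (congrArg _ this).trans (map_zero _)
  · intro y
    obtain ⟨F, hF⟩ := exists_eq_sum_homologyMap_ι L i y
    choose w hw using fun j ↦
      (hf' j).2 ((HomologicalComplex.homologyMap (Limits.Sigma.π L j) i).hom y)
    refine ⟨∑ j ∈ F, (HomologicalComplex.homologyMap (Sigma.ι K j) i).hom (w j), ?_⟩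
    rw [map_sum, hF]
    refine Finset.sum_congr rfl fun j _ ↦ ?_
    have comm : Sigma.ι K j ≫ Limits.Sigma.map f = f j ≫ Sigma.ι L j := by simp
    have := congr(HomologicalComplex.homologyMap $comm i)
    simp only [HomologicalComplex.homologyMap_comp] at this
    refine Eq.trans congr($(this).hom (w j)) ?_
    exact congrArg (HomologicalComplex.homologyMap (Sigma.ι L j) i).hom (hw j)

end

end ModuleCat

namespace HomologicalComplex

lemma exists_single_hom_cyclesMap_eq {C ι : Type*} [Category* C]
    [Abelian C] [DecidableEq ι] {c : ComplexShape ι} (K : HomologicalComplex C c) (i : ι) {A : C}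
    (φ : A ⟶ K.cycles i) :
    ∃ f : (single C c i).obj A ⟶ K,
      (singleObjCyclesSelfIso c i A).inv ≫ cyclesMap f i =
        φ := by
  refine ⟨mkHomFromSingle (φ ≫ K.iCycles i) (by simp), ?_⟩
  rw [← cancel_mono (K.iCycles i)]
  simp

end HomologicalComplex

namespace ModuleCat

lemma exists_single_hom_homologyMap_apply_eq {R : Type u} [Ring R] {ι : Type*}
    [DecidableEq ι] {c : ComplexShape ι}
    (K : HomologicalComplex (ModuleCat.{u} R) c) (i : ι) (x : K.homology i) :
    ∃ (f : (HomologicalComplex.single _ c i).obj (ModuleCat.of R R) ⟶ K)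
      (y : ((HomologicalComplex.single _ c i).obj (ModuleCat.of R R)).homology i),
      (HomologicalComplex.homologyMap f i).hom y = x := by
  obtain ⟨z, rfl⟩ := (ModuleCat.epi_iff_surjective (K.homologyπ i)).1 inferInstance x
  obtain ⟨f, hf⟩ := K.exists_single_hom_cyclesMap_eq i
    (ModuleCat.ofHom (LinearMap.toSpanSingleton R (K.cycles i) z))
  refine ⟨f, Hom.hom ((HomologicalComplex.singleObjCyclesSelfIso c i (ModuleCat.of R R)).inv ≫
    HomologicalComplex.homologyπ _ i) (1 : R), ?_⟩
  have := hf =≫ K.homologyπ i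
  rw [Category.assoc, ← HomologicalComplex.homologyπ_naturality] at this
  refine Eq.trans congr(ModuleCat.Hom.hom $this (1 : R)) ?_
  exact congrArg (K.homologyπ i).hom (one_smul R z)

end ModuleCat

namespace DerivedCategory

section

variable {R : Type u} [Ring R] [HasDerivedCategory (ModuleCat.{v} R)]
  {J : Type w} [HasCoproductsOfShape J (ModuleCat.{v} R)]

lemma homologyFunctor_sigma_hom_ext {X : J → DerivedCategory (ModuleCat.{v} R)} [HasCoproduct X]
    {n : ℤ} {M : ModuleCat.{v} R} {f g : (homologyFunctor _ n).obj (∐ X) ⟶ M}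
    (h : ∀ j, (homologyFunctor _ n).map (Sigma.ι X j) ≫ f =
      (homologyFunctor _ n).map (Sigma.ι X j) ≫ g) : f = g := by
  have := hasCoproductsOfShape (ModuleCat.{v} R) J
  let K (j : J) : CochainComplex (ModuleCat.{v} R) ℤ := Q.objPreimage (X j)
  let iso (j : J) : Q.obj (K j) ≅ X j := Q.objObjPreimageIso (X j)
  let e : Q.obj (∐ K) ≅ ∐ X := PreservesCoproduct.iso Q K ≪≫ Sigma.mapIso iso
  have he (j : J) : Q.map (Sigma.ι K j) ≫ e.hom = (iso j).hom ≫ Sigma.ι X j := by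
    have : Q.map (Sigma.ι K j) ≫ (PreservesCoproduct.iso Q K).hom =
        Sigma.ι (fun j ↦ Q.obj (K j)) j := by
      rw [← Iso.eq_comp_inv]
      simp
    simp only [e, Iso.trans_hom, reassoc_of% this]
    simp
  rw [← cancel_epi ((homologyFunctor _ n).map e.hom),
    ← cancel_epi ((homologyFunctorFactors _ n).inv.app (∐ K))]
  refine ModuleCat.homology_sigma_hom_ext n fun j ↦ ?_
  change (HomologicalComplex.homologyFunctor _ _ n).map (Sigma.ι K j) ≫ _ =
    (HomologicalComplex.homologyFunctor _ _ n).map (Sigma.ι K j) ≫ _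
  have h' := (homologyFunctorFactors _ n).inv.naturality (Sigma.ι K j)
  rw [Functor.comp_map] at h'
  rw [reassoc_of% h', reassoc_of% h', ← Functor.map_comp_assoc, ← Functor.map_comp_assoc, he,
    Functor.map_comp_assoc, Functor.map_comp_assoc, h]

end

lemma exists_singleFunctor_hom_homology_apply_eq {R : Type u} [Ring R]
    [HasDerivedCategory (ModuleCat.{u} R)] (X : DerivedCategory (ModuleCat.{u} R)) (n : ℤ)
    (x : (homologyFunctor (ModuleCat.{u} R) n).obj X) :
    ∃ (f : (singleFunctor _ n).obj (ModuleCat.of R R) ⟶ X)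
      (y : (homologyFunctor (ModuleCat.{u} R) n).obj
        ((singleFunctor _ n).obj (ModuleCat.of R R))),
      ((homologyFunctor _ n).map f).hom y = x := by
  let iso := Q.objObjPreimageIso X
  let hiso := (homologyFunctorFactors _ n).symm.app (Q.objPreimage X) ≪≫
    (homologyFunctor _ n).mapIso iso
  obtain ⟨f, y, h⟩ := ModuleCat.exists_single_hom_homologyMap_apply_eq
    (Q.objPreimage X) n (hiso.inv.hom x)
  refine ⟨Q.map f ≫ iso.hom,
    (ConcreteCategory.hom ((homologyFunctorFactors (ModuleCat.{u} R) n).inv.app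
      ((HomologicalComplex.single _ _ n).obj (ModuleCat.of R R)))) y, ?_⟩
  have comm : (homologyFunctorFactors _ n).inv.app _ ≫
      (homologyFunctor _ n).map (Q.map f ≫ iso.hom) =
      (HomologicalComplex.homologyFunctor _ _ n).map f ≫ hiso.hom := by
    have := (homologyFunctorFactors _ n).inv.naturality f
    rw [Functor.comp_map] at this
    rw [Functor.map_comp, ← reassoc_of% this]
    rfl
  refine Eq.trans congr(ModuleCat.Hom.hom $comm y) ?_
  refine (congrArg hiso.hom.hom h).trans ?_
  exact congr(ModuleCat.Hom.hom $hiso.inv_hom_id x)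

section

variable {R : Type u} [Ring R] [HasDerivedCategory (ModuleCat.{u} R)]
  (P : ObjectProperty (DerivedCategory (ModuleCat.{u} R))) [P.IsTriangulated]
  [P.IsClosedUnderIsomorphisms]

lemma prop_singleFunctor_obj {M : ModuleCat.{u} R} (hM : P ((singleFunctor _ 0).obj M)) (n : ℤ) :
    P ((singleFunctor _ n).obj M) :=
  P.prop_of_iso (((singleFunctors (ModuleCat.{u} R)).shiftIso (-n) n 0 (by simp)).app M)
    (P.le_shift (-n) _ hM)

/-- The sum of all morphisms from shifts of the ring to an object `X` is surjective in
homology. Its cone therefore receives a morphism from `X` which vanishes in homology. -/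
lemma exists_trW_homologyFunctor_map_eq_zero
    (hP : ∀ (J : Type u) (X : J → DerivedCategory (ModuleCat.{u} R)) [HasCoproduct X],
      (∀ j, P (X j)) → P (∐ X))
    (hR : P ((singleFunctor (ModuleCat.{u} R) 0).obj (ModuleCat.of R R)))
    (X : DerivedCategory (ModuleCat.{u} R)) :
    ∃ (Y : DerivedCategory (ModuleCat.{u} R)) (f : X ⟶ Y),
      P.trW f ∧ ∀ n, (homologyFunctor _ n).map f = 0 := by
  let J := Σ n : ℤ, (homologyFunctor (ModuleCat.{u} R) n).obj X
  have := hasCoproductsOfShape (ModuleCat.{u} R) J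
  choose φ y hφ using fun j : J ↦ exists_singleFunctor_hom_homology_apply_eq X j.1 j.2
  obtain ⟨Y, f, δ, hT⟩ := distinguished_cocone_triangle (Limits.Sigma.desc φ)
  refine ⟨Y, f, ObjectProperty.trW.mk' _ hT
    (hP _ _ fun j ↦ prop_singleFunctor_obj P hR j.1), fun n ↦ ?_⟩
  refine (HomologySequence.epi_homologyMap_mor₁_iff _ hT n).1 ?_
  rw [ModuleCat.epi_iff_surjective]
  intro x
  let j : J := ⟨n, x⟩
  refine ⟨((homologyFunctor _ n).map (Sigma.ι (fun j : J ↦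
    (singleFunctor _ j.1).obj (ModuleCat.of R R)) j)).hom (y j), ?_⟩
  have comm : (homologyFunctor _ n).map (Sigma.ι (fun j : J ↦
      (singleFunctor _ j.1).obj (ModuleCat.of R R)) j) ≫
      (homologyFunctor _ n).map (Limits.Sigma.desc φ) = (homologyFunctor _ n).map (φ j) := by
    rw [← Functor.map_comp, Sigma.ι_desc]
  exact congr(ModuleCat.Hom.hom $comm (y j)).trans (hφ j)

lemma isIso_one_sub_sigmaShift [HasCoproductsOfShape ℕ (DerivedCategory (ModuleCat.{u} R))]
    {X : ℕ → DerivedCategory (ModuleCat.{u} R)} (f : ∀ n, X n ⟶ X (n + 1))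
    (hf : ∀ k n, (homologyFunctor _ n).map (f k) = 0) :
    IsIso (𝟙 _ - ObjectProperty.sigmaShift f) := by
  rw [isIso_iff]
  intro n
  have h : (homologyFunctor _ n).map (ObjectProperty.sigmaShift f) = 0 :=
    homologyFunctor_sigma_hom_ext fun k ↦ by
      rw [← Functor.map_comp, ObjectProperty.ι_sigmaShift, Functor.map_comp, hf, zero_comp,
        comp_zero]
  rw [Functor.map_sub, h, sub_zero]
  infer_instance

lemma prop_of_prop_singleFunctor_of_closedUnderCoproducts
    (hP : ∀ (J : Type u) (X : J → DerivedCategory (ModuleCat.{u} R)) [HasCoproduct X],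
      (∀ j, P (X j)) → P (∐ X))
    (hR : P ((singleFunctor (ModuleCat.{u} R) 0).obj (ModuleCat.of R R)))
    (X : DerivedCategory (ModuleCat.{u} R)) : P X := by
  have := hasCoproductsOfShape (ModuleCat.{u} R) ℕ
  have := hasCoproductsOfShape (ModuleCat.{u} R) (ULift.{u} ℕ)
  have : P.IsClosedUnderColimitsOfShape (Discrete (ULift.{u} ℕ)) := by
    refine .mk' ?_
    rintro _ ⟨F, hF⟩
    refine P.prop_of_iso (HasColimit.isoOfNatIso Discrete.natIsoFunctor.symm)
      (hP _ (fun j ↦ F.obj ⟨j⟩) fun j ↦ hF _)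
  have : P.IsClosedUnderColimitsOfShape (Discrete ℕ) :=
    .of_equivalence (Discrete.equivalence Equiv.ulift)
  choose Y f hf hf' using exists_trW_homologyFunctor_map_eq_zero P hP hR
  let Z (n : ℕ) : DerivedCategory (ModuleCat.{u} R) := Nat.rec X (fun _ A ↦ Y A) n
  let φ (n : ℕ) : Z n ⟶ Z (n + 1) := f (Z n)
  have := isIso_one_sub_sigmaShift φ fun k n ↦ hf' (Z k) n
  exact P.prop_of_isIso_one_sub_sigmaShift φ fun n ↦ hf (Z n)

end

end DerivedCategory

/-- Every triangulated subcategory of the unbounded derived category `D(R)` of left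
`R`-modules which is closed under small coproducts and contains the object `R`
(the complex with `R` in degree `0`) is all of `D(R)`. Here a triangulated subcategory is
given by a predicate `P` on objects which is stable under isomorphism, closed under shifts in
both directions, and such that if two objects of a distinguished triangle satisfy `P` then so
does the third. -/
theorem eq_top_of_triangulated_subcategory_closed_under_coproducts_containing_R
    (R : Type u) [Ring R] [HasDerivedCategory (ModuleCat.{u} R)]
    (P : DerivedCategory (ModuleCat.{u} R) → Prop)
    (hiso : ∀ ⦃X Y : DerivedCategory (ModuleCat.{u} R)⦄, (X ≅ Y) → P X → P Y)
    (hshift : ∀ (X : DerivedCategory (ModuleCat.{u} R)) (n : ℤ), P X → P (X⟦n⟧))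
    (htri : ∀ T ∈ distTriang (DerivedCategory (ModuleCat.{u} R)),
      (P T.obj₁ → P T.obj₂ → P T.obj₃) ∧ (P T.obj₁ → P T.obj₃ → P T.obj₂) ∧
        (P T.obj₂ → P T.obj₃ → P T.obj₁))
    (hcoprod : ∀ (J : Type u) (X : J → DerivedCategory (ModuleCat.{u} R)) [HasCoproduct X],
      (∀ j, P (X j)) → P (∐ X))
    (hR : P ((DerivedCategory.singleFunctor (ModuleCat.{u} R) 0).obj (ModuleCat.of R R))) :
    ∀ X : DerivedCategory (ModuleCat.{u} R), P X := by
  have : ObjectProperty.IsClosedUnderIsomorphisms P := ⟨fun e h ↦ hiso e h⟩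
  have : ObjectProperty.IsStableUnderShift P ℤ :=
    { isStableUnderShiftBy n := { le_shift X hX := hshift X n hX } }
  have : ObjectProperty.ContainsZero P :=
    ⟨_, isZero_zero _, (htri _ (contractible_distinguished _)).1 hR hR⟩
  have : ObjectProperty.IsTriangulatedClosed₂ P := .mk' fun T hT h₁ h₃ ↦ (htri T hT).2.1 h₁ h₃
  have : ObjectProperty.IsTriangulated P := { }
  exact DerivedCategory.prop_of_prop_singleFunctor_of_closedUnderCoproducts P hcoprod hR
end

section
/- An object of D(R) is compact if and only if it is isomorphic in D(R) to a bounded cochain complex of finitely generated projective left R-modules. -/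
open CategoryTheory Limits

universe u

variable {R : Type u} [Ring R] [HasDerivedCategory (ModuleCat.{u} R)]

/-- The canonical map `⊕_j Hom(c, t j) → Hom(c, ∐ t)` whose component at `j` is
post-composition with the coproduct inclusion `t j ⟶ ∐ t`. -/
noncomputable def coproductComparison {J : Type u} [DecidableEq J]
    (c : DerivedCategory (ModuleCat.{u} R)) (t : J → DerivedCategory (ModuleCat.{u} R))
    [HasCoproduct t] :
    DirectSum J (fun j => c ⟶ t j) →+ (c ⟶ ∐ t) :=
  DirectSum.toAddMonoid fun j =>
    AddMonoidHom.mk' (fun φ => φ ≫ Sigma.ι t j)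
      (fun φ ψ => Preadditive.add_comp _ _ _ _ _ _)

section

variable {C : Type*} [Category* C] [Abelian C] {J : Type*}

/-- A family of cochain complexes, seen as a cochain complex of families. -/
@[simps]
abbrev CochainComplex.ofFamily (K : J → CochainComplex C ℤ) :
    CochainComplex (Discrete J ⥤ C) ℤ where
  X i := Discrete.functor fun j => (K j).X i
  d i i' := Discrete.natTrans fun j => (K j.as).d i i'
  shape i i' h := by ext j; exact (K j.as).shape i i' h
  d_comp_d' i k l _ _ := by ext j; exact (K j.as).d_comp_d i k l

/-- The morphism of complexes of families attached to a family of morphisms. -/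
@[simps]
def CochainComplex.ofFamilyMap {K L : J → CochainComplex C ℤ} (f : ∀ j, K j ⟶ L j) :
    CochainComplex.ofFamily K ⟶ CochainComplex.ofFamily L where
  f i := Discrete.natTrans fun j => (f j.as).f i
  comm' i i' _ := by ext j; exact (f j.as).comm i i'

lemma CochainComplex.quasiIso_ofFamilyMap {K L : J → CochainComplex C ℤ} (f : ∀ j, K j ⟶ L j)
    [∀ j, QuasiIso (f j)] : QuasiIso (CochainComplex.ofFamilyMap f) where
  quasiIsoAt i := by
    rw [quasiIsoAt_iff]
    constructor
    rw [NatTrans.isIso_iff_isIso_app]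
    intro j
    let F := (evaluation (Discrete J) C).obj j
    have : F.PreservesZeroMorphisms := ⟨fun _ _ => rfl⟩
    have e := ShortComplex.mapHomologyIso_hom_naturality
      ((HomologicalComplex.shortComplexFunctor _ _ i).map (CochainComplex.ofFamilyMap f)) F
    have h : IsIso (ShortComplex.homologyMap (F.mapShortComplex.map
        ((HomologicalComplex.shortComplexFunctor _ _ i).map (CochainComplex.ofFamilyMap f)))) :=
      inferInstanceAs (IsIso (HomologicalComplex.homologyMap (f j.as) i))
    have h' : IsIso (F.map (ShortComplex.homologyMap
        ((HomologicalComplex.shortComplexFunctor _ _ i).map (CochainComplex.ofFamilyMap f)))) := by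
      have := h
      rw [← (Iso.inv_comp_eq _).2 e]
      exact @IsIso.comp_isIso _ _ _ _ _ _ _ inferInstance
        (@IsIso.comp_isIso _ _ _ _ _ _ _ h inferInstance)
    exact h'



namespace CochainComplex

section Sigma

variable [HasColimitsOfShape (Discrete J) C]

/-- The degreewise coproduct of a family of cochain complexes. -/
noncomputable def sigma (K : J → CochainComplex C ℤ) : CochainComplex C ℤ where
  X i := ∐ fun j => (K j).X i
  d i i' := Limits.Sigma.map fun j => (K j).d i i'
  shape i i' h := by
    ext j
    simp [(K j).shape i i' h]
  d_comp_d' i i' i'' _ _ := by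
    ext j
    simp

/-- The inclusion of a summand in the degreewise coproduct. -/
noncomputable def sigmaInj (K : J → CochainComplex C ℤ) (j : J) (i : ℤ) :
    (K j).X i ⟶ (sigma K).X i :=
  Limits.Sigma.ι (fun j => (K j).X i) j

lemma sigmaX_hom_ext {K : J → CochainComplex C ℤ} {i : ℤ} {A : C} {f g : (sigma K).X i ⟶ A}
    (h : ∀ j, sigmaInj K j i ≫ f = sigmaInj K j i ≫ g) : f = g :=
  Limits.Sigma.hom_ext (f := fun j => (K j).X i) f g h

/-- The morphism from a degree of the degreewise coproduct given by a family of morphisms. -/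
noncomputable def sigmaXDesc {K : J → CochainComplex C ℤ} {i : ℤ} {A : C}
    (f : ∀ j, (K j).X i ⟶ A) : (sigma K).X i ⟶ A :=
  Limits.Sigma.desc f

@[simp]
lemma sigmaInj_desc {K : J → CochainComplex C ℤ} {i : ℤ} {A : C}
    (f : ∀ j, (K j).X i ⟶ A) (j : J) : sigmaInj K j i ≫ sigmaXDesc f = f j :=
  Limits.Sigma.ι_desc f j

@[simp]
lemma sigmaInj_desc_assoc {K : J → CochainComplex C ℤ} {i : ℤ} {A B : C}
    (f : ∀ j, (K j).X i ⟶ A) (j : J) (h : A ⟶ B) :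
    sigmaInj K j i ≫ sigmaXDesc f ≫ h = f j ≫ h := by
  rw [← Category.assoc, sigmaInj_desc]

@[simp]
lemma sigmaInj_d (K : J → CochainComplex C ℤ) (j : J) (i i' : ℤ) :
    sigmaInj K j i ≫ (sigma K).d i i' = (K j).d i i' ≫ sigmaInj K j i' :=
  Limits.Sigma.ι_map (fun j => (K j).d i i') j

@[simp]
lemma sigmaInj_d_assoc (K : J → CochainComplex C ℤ) (j : J) (i i' : ℤ) {A : C}
    (h : (sigma K).X i' ⟶ A) :
    sigmaInj K j i ≫ (sigma K).d i i' ≫ h = (K j).d i i' ≫ sigmaInj K j i' ≫ h := by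
  rw [← Category.assoc, sigmaInj_d, Category.assoc]

/-- The inclusion of a summand in the degreewise coproduct, as a morphism of complexes. -/
@[simps]
noncomputable def sigmaι (K : J → CochainComplex C ℤ) (j : J) : K j ⟶ sigma K where
  f i := sigmaInj K j i

/-- The morphism from the degreewise coproduct given by a family of morphisms. -/
@[simps]
noncomputable def sigmaDesc {K : J → CochainComplex C ℤ} {L : CochainComplex C ℤ}
    (f : ∀ j, K j ⟶ L) : sigma K ⟶ L where
  f i := sigmaXDesc fun j => (f j).f i
  comm' i i' _ := sigmaX_hom_ext fun j => by simp [sigmaInj_desc_assoc, sigmaInj_d_assoc]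

@[simp]
lemma sigmaι_desc {K : J → CochainComplex C ℤ} {L : CochainComplex C ℤ}
    (f : ∀ j, K j ⟶ L) (j : J) : sigmaι K j ≫ sigmaDesc f = f j := by
  ext i
  simp

@[simp]
lemma sigmaι_desc_assoc {K : J → CochainComplex C ℤ} {L M : CochainComplex C ℤ}
    (f : ∀ j, K j ⟶ L) (j : J) (h : L ⟶ M) : sigmaι K j ≫ sigmaDesc f ≫ h = f j ≫ h := by
  rw [← Category.assoc, sigmaι_desc]

lemma sigma_hom_ext {K : J → CochainComplex C ℤ} {L : CochainComplex C ℤ}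
    {f g : sigma K ⟶ L} (h : ∀ j, sigmaι K j ≫ f = sigmaι K j ≫ g) : f = g := by
  ext i
  exact sigmaX_hom_ext fun j => HomologicalComplex.congr_hom (h j) i

/-- The degreewise coproduct of a family of morphisms of cochain complexes. -/
noncomputable abbrev sigmaMap {K L : J → CochainComplex C ℤ} (f : ∀ j, K j ⟶ L j) :
    sigma K ⟶ sigma L :=
  sigmaDesc fun j => f j ≫ sigmaι L j

lemma quasiIso_sigmaMap [HasExactColimitsOfShape (Discrete J) C] {K L : J → CochainComplex C ℤ}
    (f : ∀ j, K j ⟶ L j) [∀ j, QuasiIso (f j)] : QuasiIso (sigmaMap f) := by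
  have := quasiIso_ofFamilyMap f
  have h : QuasiIso ((colim.mapHomologicalComplex (ComplexShape.up ℤ)).map (ofFamilyMap f)) := by
    infer_instance
  have e : (colim.mapHomologicalComplex (ComplexShape.up ℤ)).map (ofFamilyMap f) = sigmaMap f := by
    ext i
    refine sigmaX_hom_ext fun j => Eq.trans ?_ (sigmaInj_desc _ j).symm
    exact Limits.Sigma.ι_map (fun j => (f j).f i) j
  exact e ▸ h

end Sigma

section Pi

variable [HasLimitsOfShape (Discrete J) C]

/-- The degreewise product of a family of cochain complexes. -/
noncomputable def pi (K : J → CochainComplex C ℤ) : CochainComplex C ℤ where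
  X i := ∏ᶜ fun j => (K j).X i
  d i i' := Limits.Pi.map fun j => (K j).d i i'
  shape i i' h := by
    ext j
    simp [(K j).shape i i' h]
  d_comp_d' i i' i'' _ _ := by
    ext j
    simp

/-- The projection to a factor of the degreewise product. -/
noncomputable def piProj (K : J → CochainComplex C ℤ) (j : J) (i : ℤ) :
    (pi K).X i ⟶ (K j).X i :=
  Limits.Pi.π (fun j => (K j).X i) j

lemma piX_hom_ext {K : J → CochainComplex C ℤ} {i : ℤ} {A : C} {f g : A ⟶ (pi K).X i}
    (h : ∀ j, f ≫ piProj K j i = g ≫ piProj K j i) : f = g :=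
  Limits.Pi.hom_ext (f := fun j => (K j).X i) f g h

/-- The morphism to a degree of the degreewise product given by a family of morphisms. -/
noncomputable def piXLift {K : J → CochainComplex C ℤ} {i : ℤ} {A : C}
    (f : ∀ j, A ⟶ (K j).X i) : A ⟶ (pi K).X i :=
  Limits.Pi.lift f

@[simp]
lemma piXLift_proj {K : J → CochainComplex C ℤ} {i : ℤ} {A : C}
    (f : ∀ j, A ⟶ (K j).X i) (j : J) : piXLift f ≫ piProj K j i = f j :=
  Limits.Pi.lift_π f j

@[simp]
lemma piXLift_proj_assoc {K : J → CochainComplex C ℤ} {i : ℤ} {A B : C}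
    (f : ∀ j, A ⟶ (K j).X i) (j : J) (h : (K j).X i ⟶ B) :
    piXLift f ≫ piProj K j i ≫ h = f j ≫ h := by
  rw [← Category.assoc, piXLift_proj]

@[simp]
lemma piX_d_proj (K : J → CochainComplex C ℤ) (j : J) (i i' : ℤ) :
    (pi K).d i i' ≫ piProj K j i' = piProj K j i ≫ (K j).d i i' :=
  Limits.Pi.map_π (fun j => (K j).d i i') j

@[simp]
lemma piX_d_proj_assoc (K : J → CochainComplex C ℤ) (j : J) (i i' : ℤ) {A : C}
    (h : (K j).X i' ⟶ A) :
    (pi K).d i i' ≫ piProj K j i' ≫ h = piProj K j i ≫ (K j).d i i' ≫ h := by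
  rw [← Category.assoc, piX_d_proj, Category.assoc]

/-- The projection to a factor of the degreewise product, as a morphism of complexes. -/
@[simps]
noncomputable def piπ (K : J → CochainComplex C ℤ) (j : J) : pi K ⟶ K j where
  f i := piProj K j i

/-- The morphism to the degreewise product given by a family of morphisms. -/
@[simps]
noncomputable def piLift {K : J → CochainComplex C ℤ} {L : CochainComplex C ℤ}
    (f : ∀ j, L ⟶ K j) : L ⟶ pi K where
  f i := piXLift fun j => (f j).f i
  comm' i i' _ := piX_hom_ext fun j => by simp [piXLift_proj_assoc]

@[simp]
lemma piLift_π {K : J → CochainComplex C ℤ} {L : CochainComplex C ℤ}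
    (f : ∀ j, L ⟶ K j) (j : J) : piLift f ≫ piπ K j = f j := by
  ext i
  simp

/-- The degreewise product of a family of morphisms of cochain complexes. -/
noncomputable abbrev piMap {K L : J → CochainComplex C ℤ} (f : ∀ j, K j ⟶ L j) :
    pi K ⟶ pi L :=
  piLift fun j => piπ K j ≫ f j

lemma quasiIso_piMap [HasExactLimitsOfShape (Discrete J) C] {K L : J → CochainComplex C ℤ}
    (f : ∀ j, K j ⟶ L j) [∀ j, QuasiIso (f j)] : QuasiIso (piMap f) := by
  have := quasiIso_ofFamilyMap f
  have h : QuasiIso ((lim.mapHomologicalComplex (ComplexShape.up ℤ)).map (ofFamilyMap f)) := by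
    have : PreservesFiniteLimits (lim (J := Discrete J) (C := C)) := inferInstance
    have : PreservesFiniteColimits (lim (J := Discrete J) (C := C)) := inferInstance
    have : (lim (J := Discrete J) (C := C)).PreservesHomology := inferInstance
    have : (lim (J := Discrete J) (C := C)).Additive :=
      Functor.additive_of_preserves_binary_products _
    exact HomologicalComplex.quasiIso_map_of_preservesHomology _ _
  have e : (lim.mapHomologicalComplex (ComplexShape.up ℤ)).map (ofFamilyMap f) = piMap f := by
    ext i
    refine piX_hom_ext fun j => Eq.trans ?_ (piXLift_proj _ j).symm
    exact Limits.Pi.map_π (fun j => (f j).f i) j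
  exact e ▸ h

end Pi

end CochainComplex

end

section

variable {C : Type*} [Category* C] [Abelian C] {J : Type*}

/-- Homotopies on each summand assemble into a homotopy on the degreewise coproduct. -/
noncomputable def CochainComplex.sigmaHomotopy [HasColimitsOfShape (Discrete J) C]
    {K : J → CochainComplex C ℤ} {L : CochainComplex C ℤ} {f g : CochainComplex.sigma K ⟶ L}
    (h : ∀ j, Homotopy (CochainComplex.sigmaι K j ≫ f) (CochainComplex.sigmaι K j ≫ g)) :
    Homotopy f g where
  hom i i' := CochainComplex.sigmaXDesc fun j => (h j).hom i i'
  zero i i' hi := CochainComplex.sigmaX_hom_ext fun j => by simp [(h j).zero i i' hi]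
  comm i := CochainComplex.sigmaX_hom_ext fun j => by
    have := (h j).comm i
    simp only [HomologicalComplex.comp_f, CochainComplex.sigmaι_f] at this
    rw [this]
    simp [dNext_eq _ (show (ComplexShape.up ℤ).Rel i (i + 1) from rfl),
      prevD_eq _ (show (ComplexShape.up ℤ).Rel (i - 1) i by simp),
      CochainComplex.sigmaInj_desc_assoc, CochainComplex.sigmaInj_d_assoc]

namespace DerivedCategory

variable [HasDerivedCategory C]

lemma quotientCompQhIso_conj {K L : CochainComplex C ℤ} (f : K ⟶ L) :
    Q.map f = (quotientCompQhIso C).inv.app K ≫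
      Qh.map ((HomotopyCategory.quotient _ _).map f) ≫ (quotientCompQhIso C).hom.app L := by
  rw [quotientCompQhIso_hom_naturality, ← Category.assoc, Iso.inv_hom_id_app]
  exact (Category.id_comp _).symm

lemma exists_homotopy_of_Q_map_eq {K L : CochainComplex C ℤ} {f g : K ⟶ L}
    (h : Q.map f = Q.map g) :
    ∃ (K' : CochainComplex C ℤ) (s : K' ⟶ K), QuasiIso s ∧ Nonempty (Homotopy (s ≫ f) (s ≫ g)) := by
  have h' : Qh.map ((HomotopyCategory.quotient _ _).map f) =
      Qh.map ((HomotopyCategory.quotient _ _).map g) := by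
    rw [← cancel_mono ((quotientCompQhIso C).hom.app L), quotientCompQhIso_hom_naturality,
      quotientCompQhIso_hom_naturality, h]
  rw [MorphismProperty.map_eq_iff_precomp _ (HomotopyCategory.quasiIso C (ComplexShape.up ℤ))] at h'
  obtain ⟨X, s, hs, h'⟩ := h'
  obtain ⟨K', rfl⟩ := HomotopyCategory.quotient_obj_surjective X
  obtain ⟨s, rfl⟩ := (HomotopyCategory.quotient _ _).map_surjective s
  refine ⟨K', s, (HomotopyCategory.quotient_map_mem_quasiIso_iff s).1 hs,
    ⟨HomotopyCategory.homotopyOfEq _ _ ?_⟩⟩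
  simpa using h'

lemma exists_Q_map_eq_of_isKProjective {K L : CochainComplex C ℤ} [K.IsKProjective]
    (φ : Q.obj K ⟶ Q.obj L) : ∃ f : K ⟶ L, Q.map f = φ := by
  obtain ⟨f, hf⟩ := (CochainComplex.IsKProjective.Qh_map_bijective K
    ((HomotopyCategory.quotient _ _).obj L)).2
    ((quotientCompQhIso C).hom.app K ≫ φ ≫ (quotientCompQhIso C).inv.app L)
  obtain ⟨f, rfl⟩ := (HomotopyCategory.quotient _ _).map_surjective f
  refine ⟨f, ?_⟩
  rw [quotientCompQhIso_conj, hf]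
  simp [← NatTrans.comp_app, ← NatTrans.comp_app_assoc]

lemma exists_sigma_desc [HasColimitsOfShape (Discrete J) C] [HasExactColimitsOfShape (Discrete J) C]
    (K : J → CochainComplex C ℤ) {Y : DerivedCategory C} (f : ∀ j, Q.obj (K j) ⟶ Y) :
    ∃ g : Q.obj (CochainComplex.sigma K) ⟶ Y, ∀ j, Q.map (CochainComplex.sigmaι K j) ≫ g = f j := by
  obtain ⟨L, ⟨e⟩⟩ : ∃ L, Nonempty (Q.obj L ≅ Y) := ⟨_, ⟨Q.objObjPreimageIso Y⟩⟩
  choose K' s hs g hg using fun j => right_fac (f j ≫ e.inv)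
  have hs' : ∀ j, QuasiIso (s j) := fun j => (isIso_Q_map_iff_quasiIso C _).1 (hs j)
  have := CochainComplex.quasiIso_sigmaMap s
  have : IsIso (Q.map (CochainComplex.sigmaMap s)) := (isIso_Q_map_iff_quasiIso C _).2 this
  refine ⟨inv (Q.map (CochainComplex.sigmaMap s)) ≫ Q.map (CochainComplex.sigmaDesc g) ≫ e.hom,
    fun j => ?_⟩
  have h₁ : Q.map (CochainComplex.sigmaι K' j) ≫ Q.map (CochainComplex.sigmaMap s) =
      Q.map (s j) ≫ Q.map (CochainComplex.sigmaι K j) := by simp [← Functor.map_comp]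
  have h₂ : Q.map (CochainComplex.sigmaι K j) ≫ inv (Q.map (CochainComplex.sigmaMap s)) =
      inv (Q.map (s j)) ≫ Q.map (CochainComplex.sigmaι K' j) := by
    rw [IsIso.comp_inv_eq, Category.assoc, h₁, IsIso.inv_hom_id_assoc]
  rw [← Category.assoc, h₂, Category.assoc, ← Functor.map_comp_assoc, CochainComplex.sigmaι_desc,
    ← Category.assoc, ← hg]
  simp

lemma exists_pi_lift [HasLimitsOfShape (Discrete J) C] [HasExactLimitsOfShape (Discrete J) C]
    (K : J → CochainComplex C ℤ) {Y : DerivedCategory C} (f : ∀ j, Y ⟶ Q.obj (K j)) :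
    ∃ g : Y ⟶ Q.obj (CochainComplex.pi K), ∀ j, g ≫ Q.map (CochainComplex.piπ K j) = f j := by
  obtain ⟨L, ⟨e⟩⟩ : ∃ L, Nonempty (Q.obj L ≅ Y) := ⟨_, ⟨Q.objObjPreimageIso Y⟩⟩
  choose K' g s hs hg using fun j => left_fac (e.hom ≫ f j)
  have hs' : ∀ j, QuasiIso (s j) := fun j => (isIso_Q_map_iff_quasiIso C _).1 (hs j)
  have := CochainComplex.quasiIso_piMap s
  have : IsIso (Q.map (CochainComplex.piMap s)) := (isIso_Q_map_iff_quasiIso C _).2 this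
  refine ⟨e.inv ≫ Q.map (CochainComplex.piLift g) ≫ inv (Q.map (CochainComplex.piMap s)),
    fun j => ?_⟩
  have h₁ : Q.map (CochainComplex.piMap s) ≫ Q.map (CochainComplex.piπ K' j) =
      Q.map (CochainComplex.piπ K j) ≫ Q.map (s j) := by simp [← Functor.map_comp]
  have h₂ : inv (Q.map (CochainComplex.piMap s)) ≫ Q.map (CochainComplex.piπ K j) =
      Q.map (CochainComplex.piπ K' j) ≫ inv (Q.map (s j)) := by
    rw [IsIso.inv_comp_eq, ← Category.assoc, h₁, Category.assoc, IsIso.hom_inv_id, Category.comp_id]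
  rw [Category.assoc, Category.assoc, h₂, ← Functor.map_comp_assoc, CochainComplex.piLift_π,
    ← hg, Iso.inv_hom_id_assoc]

lemma sigma_hom_ext [HasColimitsOfShape (Discrete J) C] [HasExactColimitsOfShape (Discrete J) C]
    {K : J → CochainComplex C ℤ} {Y : DerivedCategory C}
    {f g : Q.obj (CochainComplex.sigma K) ⟶ Y}
    (h : ∀ j, Q.map (CochainComplex.sigmaι K j) ≫ f = Q.map (CochainComplex.sigmaι K j) ≫ g) :
    f = g := by
  suffices H : ∀ (f : Q.obj (CochainComplex.sigma K) ⟶ Y),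
      (∀ j, Q.map (CochainComplex.sigmaι K j) ≫ f = 0) → f = 0 by
    rw [← sub_eq_zero]
    exact H _ fun j => by rw [Preadditive.comp_sub, h, sub_self]
  clear h f g
  intro f h
  obtain ⟨L, ⟨e⟩⟩ : ∃ L, Nonempty (Q.obj L ≅ Y) := ⟨_, ⟨Q.objObjPreimageIso Y⟩⟩
  obtain ⟨L', g, s, hs, hg⟩ := left_fac (f ≫ e.inv)
  suffices Q.map g = 0 by
    rw [← cancel_mono e.inv, hg, this, zero_comp, zero_comp]
  have hj (j : J) : Q.map (CochainComplex.sigmaι K j ≫ g) =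
      Q.map (0 : K j ⟶ L') := by
    rw [← cancel_mono (inv (Q.map s)), Functor.map_comp, Category.assoc, ← hg, ← Category.assoc, h]
    simp
  choose K' t ht H using fun j => exists_homotopy_of_Q_map_eq (hj j)
  have := CochainComplex.quasiIso_sigmaMap t
  have : IsIso (Q.map (CochainComplex.sigmaMap t)) := (isIso_Q_map_iff_quasiIso C _).2 this
  rw [← cancel_epi (Q.map (CochainComplex.sigmaMap t)), comp_zero, ← Functor.map_comp,
    ← Q.map_zero]
  refine Q_map_eq_of_homotopy C (CochainComplex.sigmaHomotopy fun j => ?_)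
  have := (H j).some
  simpa [CochainComplex.sigmaι_desc_assoc] using this

end DerivedCategory

end

section

variable {C : Type*} [Category* C] [Abelian C] {J : Type*} [HasColimitsOfShape (Discrete J) C]

namespace CochainComplex

open Classical in
/-- The projection from the degreewise coproduct of complexes to a summand. -/
noncomputable def sigmaπ (K : J → CochainComplex C ℤ) (j : J) : sigma K ⟶ K j :=
  sigmaDesc fun k => if h : k = j then eqToHom (by rw [h]) else 0

@[simp]
lemma sigmaι_π_self (K : J → CochainComplex C ℤ) (j : J) : sigmaι K j ≫ sigmaπ K j = 𝟙 _ := by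
  simp [sigmaπ]

@[simp]
lemma sigmaι_π_self_assoc (K : J → CochainComplex C ℤ) (j : J) {L : CochainComplex C ℤ}
    (h : K j ⟶ L) : sigmaι K j ≫ sigmaπ K j ≫ h = h := by
  rw [← Category.assoc, sigmaι_π_self, Category.id_comp]

lemma sigmaι_π_of_ne (K : J → CochainComplex C ℤ) {k j : J} (h : k ≠ j) :
    sigmaι K k ≫ sigmaπ K j = 0 := by
  simp [sigmaπ, h]

end CochainComplex

end

namespace DerivedCategory

/-- The property that every morphism to a degreewise coproduct of complexes is a finite sum
of morphisms factoring through the summands. -/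
def IsSigmaCompact (c : DerivedCategory (ModuleCat.{u} R)) : Prop :=
  ∀ (J : Type u) (K : J → CochainComplex (ModuleCat.{u} R) ℤ)
    (f : c ⟶ Q.obj (CochainComplex.sigma K)),
    ∃ (S : Finset J) (φ : ∀ j, c ⟶ Q.obj (K j)),
      f = ∑ j ∈ S, φ j ≫ Q.map (CochainComplex.sigmaι K j)

lemma coproductComparison_apply {J : Type u} [DecidableEq J]
    (c : DerivedCategory (ModuleCat.{u} R)) (t : J → DerivedCategory (ModuleCat.{u} R))
    [HasCoproduct t] [∀ j (x : c ⟶ t j), Decidable (x ≠ 0)] (x : DirectSum J (fun j => c ⟶ t j)) :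
    coproductComparison c t x = ∑ j ∈ DFinsupp.support x, x j ≫ Sigma.ι t j := by
  conv_lhs => rw [← DirectSum.sum_support_of x]
  simp [coproductComparison]

lemma hasCoproduct_Q_obj {J : Type u} (K : J → CochainComplex (ModuleCat.{u} R) ℤ) :
    HasCoproduct fun j => (Q.obj (K j) : DerivedCategory (ModuleCat.{u} R)) := by
  choose desc hdesc using fun (t : Cofan fun j => (Q.obj (K j) : DerivedCategory (ModuleCat.{u} R)))
    => exists_sigma_desc K t.inj
  exact ⟨⟨_, Cofan.IsColimit.mk (Cofan.mk _ fun j => Q.map (CochainComplex.sigmaι K j)) desc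
    (fun t j => hdesc t j) (fun t m hm => sigma_hom_ext fun j => (hm j).trans (hdesc t j).symm)⟩⟩

lemma isSigmaCompact_of_bijective {c : DerivedCategory (ModuleCat.{u} R)}
    (hc : ∀ (J : Type u) (_ : DecidableEq J) (t : J → DerivedCategory (ModuleCat.{u} R))
      (_ : HasCoproduct t), Function.Bijective (coproductComparison c t)) :
    IsSigmaCompact c := by
  classical
  intro J K f
  have := hasCoproduct_Q_obj K
  obtain ⟨g, hg⟩ := exists_sigma_desc K fun j => Sigma.ι
    (fun j => (Q.obj (K j) : DerivedCategory (ModuleCat.{u} R))) j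
  let d : (∐ fun j => (Q.obj (K j) : DerivedCategory (ModuleCat.{u} R))) ⟶ _ :=
    Sigma.desc fun j => Q.map (CochainComplex.sigmaι K j)
  have hgd : g ≫ d = 𝟙 _ := sigma_hom_ext fun j => by simp [reassoc_of% (hg j), d]
  obtain ⟨x, hx⟩ := (hc J inferInstance _ this).2 (f ≫ g)
  refine ⟨DFinsupp.support x, fun j => x j, ?_⟩
  rw [← Category.comp_id f, ← hgd, ← Category.assoc, ← hx, coproductComparison_apply,
    Preadditive.sum_comp]
  simp [d]

lemma IsSigmaCompact.bijective {c : DerivedCategory (ModuleCat.{u} R)} (hc : IsSigmaCompact c)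
    (J : Type u) [DecidableEq J] (t : J → DerivedCategory (ModuleCat.{u} R)) [HasCoproduct t] :
    Function.Bijective (coproductComparison c t) := by
  classical
  constructor
  · rw [injective_iff_map_eq_zero]
    intro x hx
    have key (j : J) (y : DirectSum J (fun j => c ⟶ t j)) :
        coproductComparison c t y ≫ Sigma.π t j = y j := by
      rw [coproductComparison_apply, Preadditive.sum_comp]
      simp only [Category.assoc]
      rw [Finset.sum_eq_single j]
      · simp
      · intro k _ hk
        rw [Sigma.ι_π_of_ne _ hk, comp_zero]
      · intro hj
        rw [DFinsupp.notMem_support_iff.1 hj, zero_comp]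
    ext j
    rw [← key j x, hx, zero_comp]
    rfl
  · intro f
    obtain ⟨K, ⟨e⟩⟩ : ∃ K : J → CochainComplex (ModuleCat.{u} R) ℤ,
      Nonempty (∀ j, Q.obj (K j) ≅ t j) := ⟨_, ⟨fun j => Q.objObjPreimageIso (t j)⟩⟩
    let d : ∐ t ⟶ Q.obj (CochainComplex.sigma K) :=
      Sigma.desc fun j => (e j).inv ≫ Q.map (CochainComplex.sigmaι K j)
    obtain ⟨g, hg⟩ := exists_sigma_desc K fun j => (e j).hom ≫ Sigma.ι t j
    have hdg : d ≫ g = 𝟙 _ := Sigma.hom_ext _ _ fun j => by simp [d, hg]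
    obtain ⟨S, φ, h⟩ := hc J K (f ≫ d)
    refine ⟨∑ j ∈ S, DirectSum.of (fun j => c ⟶ t j) j (φ j ≫ (e j).hom), ?_⟩
    rw [← Category.comp_id f, ← hdg, ← Category.assoc, h, Preadditive.sum_comp]
    simp [coproductComparison, hg]

lemma IsSigmaCompact.of_iso {c c' : DerivedCategory (ModuleCat.{u} R)} (hc : IsSigmaCompact c)
    (e : c ≅ c') : IsSigmaCompact c' := by
  intro J K f
  obtain ⟨S, φ, h⟩ := hc J K (e.hom ≫ f)
  refine ⟨S, fun j => e.inv ≫ φ j, ?_⟩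
  rw [← cancel_epi e.hom, h, Preadditive.comp_sum]
  simp

open Pretriangulated in
lemma IsSigmaCompact.of_distTriang {T : Triangle (DerivedCategory (ModuleCat.{u} R))}
    (hT : T ∈ distTriang _) (h₁ : IsSigmaCompact T.obj₁)
    (h₃ : IsSigmaCompact T.obj₃) : IsSigmaCompact T.obj₂ := by
  classical
  intro J K f
  obtain ⟨X, w, hw, hw'⟩ : ∃ (X : DerivedCategory (ModuleCat.{u} R)) (w : X ⟶ T.obj₁),
      w ≫ T.mor₁ = 0 ∧ ∀ (Y : DerivedCategory (ModuleCat.{u} R)) (φ : T.obj₁ ⟶ Y), w ≫ φ = 0 →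
        ∃ ψ, φ = T.mor₁ ≫ ψ :=
    ⟨_, T.invRotate.mor₁, comp_distTriang_mor_zero₁₂ _ (inv_rot_of_distTriang _ hT),
      fun Y φ h => Triangle.yoneda_exact₂ _ (inv_rot_of_distTriang _ hT) φ h⟩
  obtain ⟨S, φ, h⟩ := h₁ J K (T.mor₁ ≫ f)
  have hφ (j : J) (hj : j ∈ S) : w ≫ φ j = 0 := by
    have h2 : w ≫ (T.mor₁ ≫ f) ≫ Q.map (CochainComplex.sigmaπ K j) = 0 := by
      rw [Category.assoc, reassoc_of% hw, zero_comp]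
    rw [h, Preadditive.sum_comp, Finset.sum_eq_single j] at h2
    · simpa [← Functor.map_comp] using h2
    · intro k _ hk
      rw [Category.assoc, ← Functor.map_comp, CochainComplex.sigmaι_π_of_ne _ hk]
      simp
    · exact fun h => (h hj).elim
  have hψ (j : J) : ∃ ψ : T.obj₂ ⟶ Q.obj (K j), j ∈ S → φ j = T.mor₁ ≫ ψ := by
    by_cases hj : j ∈ S
    · obtain ⟨ψ, hψ⟩ := hw' _ (φ j) (hφ j hj)
      exact ⟨ψ, fun _ => hψ⟩
    · exact ⟨0, fun h => (hj h).elim⟩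
  choose ψ hψ using hψ
  obtain ⟨g, hg⟩ := Triangle.yoneda_exact₂ _ hT
    (f - ∑ j ∈ S, ψ j ≫ Q.map (CochainComplex.sigmaι K j)) (by
      rw [Preadditive.comp_sub, h, Preadditive.comp_sum, sub_eq_zero]
      exact Finset.sum_congr rfl fun j hj => by rw [hψ j hj, Category.assoc])
  obtain ⟨S', φ', h'⟩ := h₃ J K g
  refine ⟨S ∪ S', fun j => (if j ∈ S then ψ j else 0) + if j ∈ S' then T.mor₂ ≫ φ' j else 0, ?_⟩
  have hite (S : Finset J) (j : J) (a : T.obj₂ ⟶ Q.obj (K j)) :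
      (if j ∈ S then a else 0) ≫ Q.map (CochainComplex.sigmaι K j) =
        if j ∈ S then a ≫ Q.map (CochainComplex.sigmaι K j) else 0 := by
    split_ifs <;> simp
  rw [sub_eq_iff_eq_add.1 hg, h', Preadditive.comp_sum]
  simp only [Preadditive.add_comp, Finset.sum_add_distrib, hite, Finset.sum_ite_mem,
    Finset.union_inter_cancel_left, Finset.union_inter_cancel_right, Category.assoc]
  exact add_comm _ _

end DerivedCategory

namespace CochainComplex

/-- The projection of a degreewise coproduct onto the part indexed by a finite set. -/
noncomputable def sigmaFinProj {C : Type*} [Category* C] [Abelian C] {J : Type*}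
    [HasColimitsOfShape (Discrete J) C] (K : J → CochainComplex C ℤ) (S : Finset J) :
    sigma K ⟶ sigma K :=
  ∑ j ∈ S, sigmaπ K j ≫ sigmaι K j

lemma sigmaι_finProj {C : Type*} [Category* C] [Abelian C] {J : Type*}
    [HasColimitsOfShape (Discrete J) C] (K : J → CochainComplex C ℤ) (S : Finset J) {j : J}
    (hj : j ∈ S) : sigmaι K j ≫ sigmaFinProj K S = sigmaι K j := by
  rw [sigmaFinProj, Preadditive.comp_sum, Finset.sum_eq_single j]
  · simp [sigmaι_π_self_assoc]
  · intro k _ hk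
    rw [← Category.assoc, sigmaι_π_of_ne _ hk.symm, zero_comp]
  · exact fun h => (h hj).elim

variable {A : Type u} [Ring A] {J : Type u} (K : J → CochainComplex (ModuleCat.{u} A) ℤ)

/-- The elements of the degreewise coproduct which are supported on a finite set. -/
noncomputable def sigmaFinSupp (i : ℤ) : Submodule A ((sigma K).X i) where
  carrier := {x | ∃ S, ∀ S', S ⊆ S' → ((sigmaFinProj K S').f i) x = x}
  zero_mem' := ⟨∅, fun S' _ => map_zero _⟩
  add_mem' := by
    classical
    rintro x y ⟨S, hS⟩ ⟨S', hS'⟩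
    refine ⟨S ∪ S', fun T hT => ?_⟩
    rw [map_add, hS _ (Finset.union_subset_left hT), hS' _ (Finset.union_subset_right hT)]
  smul_mem' := by
    rintro r x ⟨S, hS⟩
    refine ⟨S, fun T hT => ?_⟩
    rw [map_smul, hS T hT]

lemma sigmaFinSupp_eq_top (i : ℤ) : sigmaFinSupp K i = ⊤ := by
  classical
  have h : ModuleCat.ofHom (sigmaFinSupp K i).mkQ = 0 := sigmaX_hom_ext fun j => by
    ext x
    simp only [ModuleCat.hom_comp, LinearMap.comp_apply, comp_zero]
    refine (Submodule.Quotient.mk_eq_zero _).2 ⟨{j}, fun S' hS' => ?_⟩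
    have := HomologicalComplex.congr_hom (sigmaι_finProj K S' (hS' (Finset.mem_singleton_self j))) i
    exact ConcreteCategory.congr_hom this x
  rw [← Submodule.ker_mkQ (sigmaFinSupp K i), LinearMap.ker_eq_top]
  exact congrArg ModuleCat.Hom.hom h

lemma exists_finset_comp_sigmaFinProj_f (M : ModuleCat.{u} A) [Module.Finite A M] (i : ℤ)
    (f : M ⟶ (sigma K).X i) :
    ∃ S, ∀ S', S ⊆ S' → f ≫ (sigmaFinProj K S').f i = f := by
  classical
  obtain ⟨G, hG⟩ := (Module.finite_def (R := A) (M := M)).1 inferInstance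
  have (x : M) : ∃ S, ∀ S', S ⊆ S' → ((sigmaFinProj K S').f i) (f x) = f x := by
    have : f x ∈ sigmaFinSupp K i := by rw [sigmaFinSupp_eq_top]; trivial
    exact this
  choose S hS using this
  refine ⟨G.biUnion S, fun T hT => ?_⟩
  ext1
  refine LinearMap.ext_on hG fun x hx => ?_
  exact hS x T ((Finset.subset_biUnion_of_mem S hx).trans hT)

/-- A bounded complex of finitely generated projective modules. -/
structure IsPerfectComplex (Z : CochainComplex (ModuleCat.{u} A) ℤ) : Prop where
  bounded : ∃ a b : ℤ, ∀ j : ℤ, (j < a ∨ b < j) → IsZero (Z.X j)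
  finite : ∀ j : ℤ, Module.Finite A (Z.X j)
  projective : ∀ j : ℤ, Module.Projective A (Z.X j)

lemma IsPerfectComplex.isKProjective {Z : CochainComplex (ModuleCat.{u} A) ℤ}
    (hZ : IsPerfectComplex Z) : Z.IsKProjective := by
  obtain ⟨a, b, hab⟩ := hZ.bounded
  have : Z.IsStrictlyLE b := (isStrictlyLE_iff _ _).2 fun i hi => hab i (Or.inr hi)
  have : ∀ n, Projective (Z.X n) := fun n => by
    have := hZ.projective n
    infer_instance
  exact isKProjective_of_projective Z b

lemma IsPerfectComplex.exists_finset {Z : CochainComplex (ModuleCat.{u} A) ℤ}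
    (hZ : IsPerfectComplex Z) (f : Z ⟶ sigma K) : ∃ S, f ≫ sigmaFinProj K S = f := by
  classical
  obtain ⟨a, b, hab⟩ := hZ.bounded
  have (i : ℤ) : ∃ S, ∀ S', S ⊆ S' → f.f i ≫ (sigmaFinProj K S').f i = f.f i := by
    have := hZ.finite i
    exact exists_finset_comp_sigmaFinProj_f K (Z.X i) i (f.f i)
  choose S hS using this
  refine ⟨(Finset.Icc a b).biUnion S, ?_⟩
  ext1 i
  by_cases hi : i ∈ Finset.Icc a b
  · exact hS i _ (Finset.subset_biUnion_of_mem S hi)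
  · exact (hab i (by rw [Finset.mem_Icc] at hi; omega)).eq_of_src _ _

lemma isPerfectComplex_single (M : ModuleCat.{u} A) [Module.Finite A M] [Module.Projective A M]
    (a : ℤ) : IsPerfectComplex ((singleFunctor (ModuleCat.{u} A) a).obj M) := by
  refine ⟨⟨a, a, fun j hj => ?_⟩, fun j => ?_, fun j => ?_⟩
  · exact HomologicalComplex.isZero_single_obj_X _ _ _ _ (by omega)
  all_goals
    by_cases hj : j = a
    · subst hj
      let e := (HomologicalComplex.singleObjXSelf (ComplexShape.up ℤ) j M).toLinearEquiv
      first
        | exact Module.Finite.equiv e.symm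
        | exact Module.Projective.of_equiv e.symm
    · have : Subsingleton (((singleFunctor (ModuleCat.{u} A) a).obj M).X j) :=
        ModuleCat.subsingleton_of_isZero (HomologicalComplex.isZero_single_obj_X _ _ _ _ hj)
      infer_instance

end CochainComplex

namespace DerivedCategory

/-- The property of being isomorphic to a bounded complex of finitely generated projective
modules. -/
def IsPerfect (c : DerivedCategory (ModuleCat.{u} R)) : Prop :=
  ∃ Z : CochainComplex (ModuleCat.{u} R) ℤ, Z.IsPerfectComplex ∧ Nonempty (c ≅ Q.obj Z)

lemma IsPerfect.isSigmaCompact {c : DerivedCategory (ModuleCat.{u} R)} (hc : IsPerfect c) :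
    IsSigmaCompact c := by
  obtain ⟨Z, hZ, ⟨e⟩⟩ := hc
  refine IsSigmaCompact.of_iso (fun J K f => ?_) e.symm
  have := hZ.isKProjective
  obtain ⟨f, rfl⟩ := exists_Q_map_eq_of_isKProjective f
  obtain ⟨S, hS⟩ := hZ.exists_finset K f
  refine ⟨S, fun j => Q.map (f ≫ CochainComplex.sigmaπ K j), ?_⟩
  conv_lhs => rw [← hS, CochainComplex.sigmaFinProj, Preadditive.comp_sum]
  simp [Functor.map_sum]

lemma IsPerfect.of_iso {c c' : DerivedCategory (ModuleCat.{u} R)} (hc : IsPerfect c)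
    (e : c ≅ c') : IsPerfect c' := by
  obtain ⟨Z, hZ, ⟨e'⟩⟩ := hc
  exact ⟨Z, hZ, ⟨e.symm ≪≫ e'⟩⟩

lemma IsPerfect.shift {c : DerivedCategory (ModuleCat.{u} R)} (hc : IsPerfect c) (n : ℤ) :
    IsPerfect (c⟦n⟧) := by
  obtain ⟨Z, hZ, ⟨e⟩⟩ := hc
  refine ⟨Z⟦n⟧, ⟨?_, fun j => hZ.finite (j + n), fun j => hZ.projective (j + n)⟩,
    ⟨(shiftFunctor _ n).mapIso e ≪≫ ((Q.commShiftIso n).app Z).symm⟩⟩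
  obtain ⟨a, b, hab⟩ := hZ.bounded
  exact ⟨a - n, b - n, fun j hj => hab (j + n) (by omega)⟩

lemma isPerfect_single (M : ModuleCat.{u} R) [Module.Finite R M] [Module.Projective R M] (a : ℤ) :
    IsPerfect ((singleFunctor (ModuleCat.{u} R) a).obj M) :=
  ⟨_, CochainComplex.isPerfectComplex_single M a, ⟨(singleFunctorIsoCompQ _ a).app M⟩⟩

open Pretriangulated in
lemma IsPerfect.of_distTriang {T : Triangle (DerivedCategory (ModuleCat.{u} R))}
    (hT : T ∈ distTriang _) (h₁ : IsPerfect T.obj₁) (h₂ : IsPerfect T.obj₂) :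
    IsPerfect T.obj₃ := by
  obtain ⟨Z₁, hZ₁, ⟨e₁⟩⟩ := h₁
  obtain ⟨Z₂, hZ₂, ⟨e₂⟩⟩ := h₂
  have := hZ₁.isKProjective
  obtain ⟨f, hf⟩ := exists_Q_map_eq_of_isKProjective (e₁.inv ≫ T.mor₁ ≫ e₂.hom)
  have e := isoTriangleOfIso₁₂ _ _ hT (mappingCone_triangle_distinguished f) e₁ e₂
    (by
      change T.mor₁ ≫ e₂.hom = e₁.hom ≫ Q.map f
      simp [hf])
  refine ⟨CochainComplex.mappingCone f, ⟨?_, fun j => ?_, fun j => ?_⟩, ⟨Triangle.π₃.mapIso e⟩⟩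
  · obtain ⟨a₁, b₁, h₁⟩ := hZ₁.bounded
    obtain ⟨a₂, b₂, h₂⟩ := hZ₂.bounded
    refine ⟨min (a₁ - 1) a₂, max b₁ b₂, fun j hj => ?_⟩
    rw [CochainComplex.mappingCone.isZero_X_iff]
    exact ⟨h₁ _ (by omega), h₂ _ (by omega)⟩
  all_goals
    let e := (HomologicalComplex.homotopyCofiber.XIsoBiprod f j (j + 1) rfl ≪≫
      ModuleCat.biprodIsoProd _ _).toLinearEquiv
    have := hZ₁.finite (j + 1)
    have := hZ₂.finite j
    have := hZ₁.projective (j + 1)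
    have := hZ₂.projective j
    first
      | exact Module.Finite.equiv e.symm
      | exact Module.Projective.of_equiv e.symm

end DerivedCategory

section

variable {C : Type*} [Category* C] [Abelian C] {J : Type*} [HasColimitsOfShape (Discrete J) C]
  [HasLimitsOfShape (Discrete J) C]

namespace CochainComplex

/-- The canonical morphism from the product to the coproduct of a family of complexes which is
finite in each degree. -/
noncomputable def piToSigma (K : J → CochainComplex C ℤ) (S : ℤ → Finset J)
    (hS : ∀ i j, j ∉ S i → IsZero ((K j).X i)) : pi K ⟶ sigma K where
  f i := ∑ j ∈ S i, piProj K j i ≫ sigmaInj K j i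
  comm' i i' _ := by
    classical
    have h₁ : ∑ j ∈ S i, piProj K j i ≫ (K j).d i i' ≫ sigmaInj K j i' =
        ∑ j ∈ S i ∪ S i', piProj K j i ≫ (K j).d i i' ≫ sigmaInj K j i' :=
      Finset.sum_subset Finset.subset_union_left fun j _ hj => by
        rw [(hS i j hj).eq_of_src ((K j).d i i') 0, zero_comp, comp_zero]
    have h₂ : ∑ j ∈ S i', piProj K j i ≫ (K j).d i i' ≫ sigmaInj K j i' =
        ∑ j ∈ S i ∪ S i', piProj K j i ≫ (K j).d i i' ≫ sigmaInj K j i' :=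
      Finset.sum_subset Finset.subset_union_right fun j _ hj => by
        rw [(hS i' j hj).eq_of_tgt ((K j).d i i') 0, zero_comp, comp_zero]
    simp only [Preadditive.sum_comp, Preadditive.comp_sum, Category.assoc, sigmaInj_d,
      piX_d_proj_assoc]
    rw [h₁, h₂]

lemma piToSigma_π (K : J → CochainComplex C ℤ) (S : ℤ → Finset J)
    (hS : ∀ i j, j ∉ S i → IsZero ((K j).X i)) (j : J) :
    piToSigma K S hS ≫ sigmaπ K j = piπ K j := by
  ext i
  have h₁ : sigmaInj K j i ≫ (sigmaπ K j).f i = 𝟙 _ :=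
    HomologicalComplex.congr_hom (sigmaι_π_self K j) i
  have h₂ (k : J) (hk : k ≠ j) : sigmaInj K k i ≫ (sigmaπ K j).f i = 0 :=
    HomologicalComplex.congr_hom (sigmaι_π_of_ne K hk) i
  simp only [piToSigma, HomologicalComplex.comp_f, Preadditive.sum_comp, Category.assoc, piπ_f]
  rw [Finset.sum_eq_single j]
  · rw [h₁, Category.comp_id]
  · intro k _ hk
    rw [h₂ k hk, comp_zero]
  · intro hj
    exact (hS i j hj).eq_of_tgt _ _

end CochainComplex

namespace DerivedCategory

variable {C : Type*} [Category* C] [Abelian C] [HasDerivedCategory C]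

lemma isLE_of_retract {X Y : DerivedCategory C} (r : Retract X Y) (n : ℤ) [Y.IsLE n] :
    X.IsLE n := by
  rw [isLE_iff]
  intro i hi
  have := Y.isZero_of_isLE n i hi
  rw [IsZero.iff_id_eq_zero, ← (r.map (homologyFunctor C i)).retract]
  exact (congrArg (· ≫ _) (this.eq_of_tgt _ 0)).trans zero_comp

lemma isGE_of_retract {X Y : DerivedCategory C} (r : Retract X Y) (n : ℤ) [Y.IsGE n] :
    X.IsGE n := by
  rw [isGE_iff]
  intro i hi
  have := Y.isZero_of_isGE n i hi
  rw [IsZero.iff_id_eq_zero, ← (r.map (homologyFunctor C i)).retract]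
  exact (congrArg (· ≫ _) (this.eq_of_tgt _ 0)).trans zero_comp

end DerivedCategory

end

namespace DerivedCategory

lemma IsSigmaCompact.finite_ne_zero {c : DerivedCategory (ModuleCat.{u} R)}
    (hc : IsSigmaCompact c) {J : Type u} (K : J → CochainComplex (ModuleCat.{u} R) ℤ)
    (hK : ∀ i, ∃ S : Finset J, ∀ j, j ∉ S → IsZero ((K j).X i)) (g : ∀ j, c ⟶ Q.obj (K j)) :
    ∃ S : Finset J, ∀ j, j ∉ S → g j = 0 := by
  choose S hS using hK
  obtain ⟨h, hh⟩ := exists_pi_lift K g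
  obtain ⟨T, φ, hφ⟩ := hc J K (h ≫ Q.map (CochainComplex.piToSigma K S hS))
  refine ⟨T, fun j hj => ?_⟩
  rw [← hh, ← CochainComplex.piToSigma_π K S hS, Functor.map_comp, ← Category.assoc, hφ,
    Preadditive.sum_comp]
  refine Finset.sum_eq_zero fun k hk => ?_
  rw [Category.assoc, ← Functor.map_comp, CochainComplex.sigmaι_π_of_ne _
    (by rintro rfl; exact hj hk), Functor.map_zero, comp_zero]

open Pretriangulated in
lemma IsSigmaCompact.exists_isLE {c : DerivedCategory (ModuleCat.{u} R)}
    (hc : IsSigmaCompact c) : ∃ b : ℤ, c.IsLE b := by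
  have (n : ULift.{u} ℕ) : ∃ (K : CochainComplex (ModuleCat.{u} R) ℤ) (g : c ⟶ Q.obj K),
      K.IsStrictlyGE (n.down + 1) ∧ (g = 0 → c.IsLE n.down) := by
    obtain ⟨X, Y, hX, hY, f, g, h, hT⟩ := TStructure.t.exists_triangle c n.down (n.down + 1) rfl
    have : Y.IsGE (n.down + 1) := ⟨hY⟩
    have : X.IsLE n.down := ⟨hX⟩
    obtain ⟨K, hK, ⟨e⟩⟩ := exists_iso_Q_obj_of_isGE Y (n.down + 1)
    refine ⟨K, g ≫ e.hom, hK, fun h0 => ?_⟩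
    have hg : g = 0 := by rw [← cancel_mono e.hom, h0, zero_comp]
    obtain ⟨s, hs⟩ : ∃ s : c ⟶ X, 𝟙 c = s ≫ f := Triangle.coyoneda_exact₂ _ hT (𝟙 c) (by
      change 𝟙 c ≫ g = 0
      rw [hg, comp_zero])
    exact isLE_of_retract ⟨s, f, hs.symm⟩ n.down
  choose K g hK hg using this
  obtain ⟨S, hS⟩ := hc.finite_ne_zero K (fun i => by
    refine ⟨(Finset.range i.toNat).map Equiv.ulift.symm.toEmbedding, fun j hj => ?_⟩
    have := hK j
    refine CochainComplex.isZero_of_isStrictlyGE (K j) (j.down + 1) i ?_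
    by_contra! h
    exact hj (Finset.mem_map.2 ⟨j.down, Finset.mem_range.2 (by omega), rfl⟩)) g
  obtain ⟨j, hj⟩ := Infinite.exists_notMem_finset S
  exact ⟨_, hg j (hS j hj)⟩

lemma IsSigmaCompact.exists_hom_eq_zero {c : DerivedCategory (ModuleCat.{u} R)}
    (hc : IsSigmaCompact c) :
    ∃ a : ℤ, ∀ (Y : DerivedCategory (ModuleCat.{u} R)), Y.IsLE (a - 1) → ∀ f : c ⟶ Y, f = 0 := by
  by_contra! H
  have (n : ULift.{u} ℕ) : ∃ (K : CochainComplex (ModuleCat.{u} R) ℤ) (g : c ⟶ Q.obj K),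
      K.IsStrictlyLE (-n.down - 1) ∧ g ≠ 0 := by
    obtain ⟨Y, hY, f, hf⟩ := H (-n.down)
    obtain ⟨K, hK, ⟨e⟩⟩ := exists_iso_Q_obj_of_isLE Y (-n.down - 1)
    refine ⟨K, f ≫ e.hom, hK, fun h => hf ?_⟩
    rw [← cancel_mono e.hom, h, zero_comp]
  choose K g hK hg using this
  obtain ⟨S, hS⟩ := hc.finite_ne_zero K (fun i => by
    refine ⟨(Finset.range (-i).toNat).map Equiv.ulift.symm.toEmbedding, fun j hj => ?_⟩
    have := hK j
    refine CochainComplex.isZero_of_isStrictlyLE (K j) (-j.down - 1) i ?_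
    by_contra! h
    exact hj (Finset.mem_map.2 ⟨j.down, Finset.mem_range.2 (by omega), rfl⟩)) g
  obtain ⟨j, hj⟩ := Infinite.exists_notMem_finset S
  exact hg j (hS j hj)

end DerivedCategory

namespace CochainComplex

variable {A : Type u} [Ring A]

/-- The free module of rank one, as a complex concentrated in a given degree. -/
noncomputable abbrev singleRing (A : Type u) [Ring A] (a : ℤ) :
    CochainComplex (ModuleCat.{u} A) ℤ :=
  (singleFunctor (ModuleCat.{u} A) a).obj (ModuleCat.of A A)

section

variable (K : CochainComplex (ModuleCat.{u} A) ℤ) (a : ℤ) [K.IsStrictlyLE a]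

/-- The morphism from the rank one free module in the top degree of a complex which is given by
an element of this complex. -/
noncomputable def fromSingleRing (x : K.X a) : singleRing A a ⟶ K :=
  HomologicalComplex.mkHomFromSingle (ModuleCat.ofHom (LinearMap.toSpanSingleton A _ x))
    (fun k hk => (K.isZero_of_isStrictlyLE a k (by
      simp only [ComplexShape.up_Rel] at hk; omega)).eq_of_tgt _ _)

lemma exists_fromSingleRing_f (x : K.X a) : ∃ y, ((fromSingleRing K a x).f a) y = x := by
  let e := HomologicalComplex.singleObjXSelf (ComplexShape.up ℤ) a (ModuleCat.of A A)
  have h : e.inv ≫ (fromSingleRing K a x).f a =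
      ModuleCat.ofHom (LinearMap.toSpanSingleton A _ x) := by
    rw [fromSingleRing, HomologicalComplex.mkHomFromSingle_f, Iso.inv_hom_id_assoc]
  exact ⟨e.inv (1 : A), (ConcreteCategory.congr_hom h (1 : A)).trans (one_smul A x)⟩

/-- The morphism to a complex from a free module placed in its top degree, given by all the
elements of the complex in this degree. -/
noncomputable def fromFree : sigma (fun _ : K.X a => singleRing A a) ⟶ K :=
  sigmaDesc fun x => fromSingleRing K a x

lemma epi_fromFree_f : Epi ((fromFree K a).f a) := by
  rw [ModuleCat.epi_iff_surjective]
  intro x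
  obtain ⟨y, hy⟩ := exists_fromSingleRing_f K a x
  refine ⟨(sigmaι (fun _ : K.X a => singleRing A a) x).f a y, ?_⟩
  have := HomologicalComplex.congr_hom (sigmaι_desc (fun x => fromSingleRing K a x) x) a
  exact (ConcreteCategory.congr_hom this y).trans hy

lemma isZero_sigma_singleRing_X (B : Type u) (i : ℤ) (hi : i ≠ a) :
    IsZero ((sigma (fun _ : B => singleRing A a)).X i) := by
  rw [IsZero.iff_id_eq_zero]
  exact sigmaX_hom_ext fun j =>
    (HomologicalComplex.isZero_single_obj_X _ _ _ _ hi).eq_of_src _ _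

lemma isZero_pi_singleRing_X (B : Type u) (i : ℤ) (hi : i ≠ a) :
    IsZero ((pi (fun _ : B => singleRing A a)).X i) := by
  rw [IsZero.iff_id_eq_zero]
  exact piX_hom_ext fun j =>
    (HomologicalComplex.isZero_single_obj_X _ _ _ _ hi).eq_of_tgt _ _

lemma isLE_mappingCone_fromFree : (mappingCone (fromFree K a)).IsLE (a - 1) := by
  have hz (i : ℤ) (hi : a < i) : IsZero ((mappingCone (fromFree K a)).X i) := by
    rw [mappingCone.isZero_X_iff]
    exact ⟨isZero_sigma_singleRing_X _ _ _ (by omega), K.isZero_of_isStrictlyLE a i hi⟩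
  rw [isLE_iff]
  intro i hi
  obtain rfl | hi' : i = a ∨ a < i := by omega
  · rw [HomologicalComplex.exactAt_iff' _ (i - 1) i (i + 1) (by simp) (by simp),
      ShortComplex.exact_iff_epi _ ((hz (i + 1) (by omega)).eq_of_tgt _ _)]
    suffices ∀ {Z : ModuleCat.{u} A} (g g' : (mappingCone (fromFree K i)).X i ⟶ Z),
        (mappingCone (fromFree K i)).d (i - 1) i ≫ g =
          (mappingCone (fromFree K i)).d (i - 1) i ≫ g' → g = g' from
      ⟨fun g g' h => this g g' h⟩
    intro Z g g' h
    have h₀ : (mappingCone.inl (fromFree K i)).v i (i - 1) (by omega) ≫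
        (mappingCone (fromFree K i)).d (i - 1) i =
        (fromFree K i).f i ≫ (mappingCone.inr (fromFree K i)).f i := by
      rw [mappingCone.inl_v_d (fromFree K i) i (i - 1) (i + 1) (by omega) (by omega),
        (isZero_sigma_singleRing_X i (K.X i) (i + 1) (by omega)).eq_of_tgt
          ((sigma (fun _ : K.X i => singleRing A i)).d i (i + 1)) 0, zero_comp, sub_zero]
    have := epi_fromFree_f K i
    refine mappingCone.ext_from (fromFree K i) (i + 1) i rfl ?_ ?_
    · exact (isZero_sigma_singleRing_X i (K.X i) (i + 1) (by omega)).eq_of_src _ _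
    · rw [← cancel_epi ((fromFree K i).f i), ← Category.assoc, ← Category.assoc, ← h₀,
        Category.assoc, Category.assoc, h]
  · rw [HomologicalComplex.exactAt_iff]
    exact ShortComplex.exact_of_isZero_X₂ _ (hz i hi')

end

end CochainComplex

namespace DerivedCategory

open Pretriangulated

lemma mk_comp_iso_mem_distTriang {C : Type*} [Category* C] [Preadditive C] [HasZeroObject C]
    [HasShift C ℤ] [∀ n : ℤ, (shiftFunctor C n).Additive] [Pretriangulated C]
    {T : Triangle C} (hT : T ∈ distTriang C) {Y : C} (e : Y ≅ T.obj₂) :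
    Triangle.mk (T.mor₁ ≫ e.inv) (e.hom ≫ T.mor₂) T.mor₃ ∈ distTriang C := by
  refine isomorphic_distinguished T hT _
    (Triangle.isoMk _ _ (Iso.refl _) e (Iso.refl _) ?_ ?_ ?_)
  · change (T.mor₁ ≫ e.inv) ≫ e.hom = 𝟙 _ ≫ T.mor₁
    simp
  · change (e.hom ≫ T.mor₂) ≫ 𝟙 _ = e.hom ≫ T.mor₂
    simp
  · change T.mor₃ ≫ (shiftFunctor C (1 : ℤ)).map (𝟙 _) = 𝟙 _ ≫ T.mor₃
    simp

lemma exists_triangle_of_isLE (Y : DerivedCategory (ModuleCat.{u} R)) (a : ℤ) [Y.IsLE a] :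
    ∃ (B : Type u) (Z : DerivedCategory (ModuleCat.{u} R))
      (β : Q.obj (CochainComplex.sigma (fun _ : B => CochainComplex.singleRing R a)) ⟶ Y)
      (f : Y ⟶ Z) (h : Z ⟶ _), Triangle.mk β f h ∈ distTriang _ ∧ Z.IsLE (a - 1) := by
  obtain ⟨K, hK, ⟨e⟩⟩ := exists_iso_Q_obj_of_isLE Y a
  have := CochainComplex.isLE_mappingCone_fromFree K a
  exact ⟨K.X a, Q.obj (CochainComplex.mappingCone (CochainComplex.fromFree K a)), _, _, _,
    mk_comp_iso_mem_distTriang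
      (mappingCone_triangle_distinguished (CochainComplex.fromFree K a)) e, inferInstance⟩

lemma small_hom_singleRing (a : ℤ) (T : DerivedCategory (ModuleCat.{u} R)) :
    Small.{u} (Q.obj (CochainComplex.singleRing R a) ⟶ T) := by
  obtain ⟨K, ⟨e⟩⟩ : ∃ K, Nonempty (Q.obj K ≅ T) := ⟨_, ⟨Q.objObjPreimageIso T⟩⟩
  have := (CochainComplex.isPerfectComplex_single (ModuleCat.of R R) a).isKProjective
  refine small_of_surjective (f := fun f : CochainComplex.singleRing R a ⟶ K => Q.map f ≫ e.hom)
    fun g => ?_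
  obtain ⟨f, hf⟩ := exists_Q_map_eq_of_isKProjective (g ≫ e.inv)
  exact ⟨f, by simp [hf]⟩

lemma small_hom_of_isLE_of_isGE (X T : DerivedCategory (ModuleCat.{u} R)) (a b : ℤ)
    [X.IsLE b] [T.IsGE a] : Small.{u} (X ⟶ T) := by
  obtain ⟨n, hn⟩ : ∃ n : ℕ, b < a + n := ⟨(b + 1 - a).toNat, by omega⟩
  induction n generalizing X b with
  | zero =>
    have : Subsingleton (X ⟶ T) := ⟨fun f g => by
      rw [TStructure.t.zero f b a (by omega), TStructure.t.zero g b a (by omega)]⟩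
    infer_instance
  | succ n hn' =>
    obtain ⟨B, Z, β, f, h, hT, hZ⟩ := exists_triangle_of_isLE X b
    have := hn' Z (b - 1) (by push_cast at hn; omega)
    have := small_hom_singleRing b T
    have : Small.{u} (Q.obj (CochainComplex.sigma
        (fun _ : B => CochainComplex.singleRing R b)) ⟶ T) :=
      small_of_injective (f := fun g (j : B) =>
        Q.map (CochainComplex.sigmaι (fun _ : B => CochainComplex.singleRing R b) j) ≫ g)
        fun g g' hg => sigma_hom_ext fun j => congrFun hg j
    have (g : Set.range fun g : X ⟶ T => β ≫ g) : ∃ g' : X ⟶ T, β ≫ g' = g := g.2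
    choose s hs using this
    refine small_of_surjective (f := fun p : (Set.range fun g : X ⟶ T => β ≫ g) × (Z ⟶ T) =>
      s p.1 + f ≫ p.2) fun g => ?_
    obtain ⟨k, hk⟩ : ∃ k : Z ⟶ T, g - s ⟨β ≫ g, g, rfl⟩ = f ≫ k :=
      Triangle.yoneda_exact₂ _ hT (g - s ⟨β ≫ g, g, rfl⟩) (by
        change β ≫ (g - s ⟨β ≫ g, g, rfl⟩) = 0
        rw [Preadditive.comp_sub, hs, sub_self])
    exact ⟨(⟨β ≫ g, g, rfl⟩, k), by simp [← hk]⟩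

/-- The free module on a type, placed in a given degree. -/
noncomputable abbrev freeSingle (R : Type u) [Ring R] [HasDerivedCategory (ModuleCat.{u} R)]
    (I : Type u) (a : ℤ) : DerivedCategory (ModuleCat.{u} R) :=
  (singleFunctor (ModuleCat.{u} R) a).obj (ModuleCat.of R (I → R))

lemma exists_lift_freeSingle {c : DerivedCategory (ModuleCat.{u} R)} {a : ℤ} {I : Type u}
    [Fintype I]
    (φ : I → (c ⟶ Q.obj (CochainComplex.singleRing R a))) :
    ∃ (α : c ⟶ freeSingle R I a)
      (p : I → (freeSingle R I a ⟶ Q.obj (CochainComplex.singleRing R a))),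
      ∀ i, α ≫ p i = φ i := by
  classical
  let e : (singleFunctor (ModuleCat.{u} R) a).obj (ModuleCat.of R R) ≅
    Q.obj (CochainComplex.singleRing R a) := (singleFunctorIsoCompQ _ a).app _
  let ι (i : I) : ModuleCat.of R R ⟶ ModuleCat.of R (I → R) :=
    ModuleCat.ofHom (LinearMap.single R (fun _ => R) i)
  let π (i : I) : ModuleCat.of R (I → R) ⟶ ModuleCat.of R R :=
    ModuleCat.ofHom (LinearMap.proj i)
  have hιπ (i j : I) : ι i ≫ π j = if i = j then 𝟙 _ else 0 := by
    ext
    split_ifs with h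
    · subst h
      simp [ι, π]
    · simp [ι, π, Ne.symm h]
  refine ⟨∑ i, φ i ≫ e.inv ≫ (singleFunctor (ModuleCat.{u} R) a).map (ι i),
    fun i => (singleFunctor (ModuleCat.{u} R) a).map (π i) ≫ e.hom, fun i => ?_⟩
  rw [Preadditive.sum_comp, Finset.sum_eq_single i]
  · simp [← Functor.map_comp_assoc, hιπ]
  · intro j _ hj
    simp [← Functor.map_comp_assoc, hιπ, hj]
  · simp

section

variable {c : DerivedCategory (ModuleCat.{u} R)} {a : ℤ}

lemma IsSigmaCompact.exists_eq_sum (hc : IsSigmaCompact c)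
    (ha : ∀ (Y : DerivedCategory (ModuleCat.{u} R)), Y.IsLE (a - 1) → ∀ f : c ⟶ Y, f = 0)
    {Y : DerivedCategory (ModuleCat.{u} R)} [Y.IsLE a] (g : c ⟶ Y) :
    ∃ (B : Type u) (S : Finset B) (φ : B → (c ⟶ Q.obj (CochainComplex.singleRing R a)))
      (ψ : B → (Q.obj (CochainComplex.singleRing R a) ⟶ Y)), g = ∑ s ∈ S, φ s ≫ ψ s := by
  obtain ⟨B, Z, β, f, h, hT, hZ⟩ := exists_triangle_of_isLE Y a
  obtain ⟨k, rfl⟩ : ∃ k, g = k ≫ β := Triangle.coyoneda_exact₂ _ hT g (ha Z hZ (g ≫ f))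
  obtain ⟨S, φ, rfl⟩ := hc B _ k
  refine ⟨B, S, φ, fun j => Q.map
    (CochainComplex.sigmaι (fun _ : B => CochainComplex.singleRing R a) j) ≫ β, ?_⟩
  simp [Preadditive.sum_comp]

lemma IsSigmaCompact.exists_hom_freeSingle (hc : IsSigmaCompact c) {b : ℤ} [c.IsLE b]
    (ha : ∀ (Y : DerivedCategory (ModuleCat.{u} R)), Y.IsLE (a - 1) → ∀ f : c ⟶ Y, f = 0) :
    ∃ (I : Type u) (_ : Finite I) (α : c ⟶ freeSingle R I a),
      ∀ (Y : DerivedCategory (ModuleCat.{u} R)), Y.IsLE a → ∀ g : c ⟶ Y, ∃ γ, g = α ≫ γ := by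
  have : (Q.obj (CochainComplex.singleRing R a)).IsGE a :=
    TStructure.t.isGE_of_iso ((singleFunctorIsoCompQ _ a).app (ModuleCat.of R R)) a
  have := small_hom_of_isLE_of_isGE c (Q.obj (CochainComplex.singleRing R a)) a b
  let F (_ : Shrink.{u} (c ⟶ Q.obj (CochainComplex.singleRing R a))) :=
    CochainComplex.singleRing R a
  have : (CochainComplex.pi F).IsStrictlyLE a := (CochainComplex.isStrictlyLE_iff _ _).2
    fun i hi => CochainComplex.isZero_pi_singleRing_X a _ i hi.ne'
  obtain ⟨g, hg⟩ := exists_pi_lift F fun j => (equivShrink _).symm j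
  obtain ⟨B, S, φ, ψ, hS⟩ := hc.exists_eq_sum ha g
  obtain ⟨α, p, hp⟩ := exists_lift_freeSingle fun s : S => φ s
  have key (f : c ⟶ Q.obj (CochainComplex.singleRing R a)) : ∃ γ, f = α ≫ γ := by
    refine ⟨∑ s : S, p s ≫ ψ s ≫ Q.map (CochainComplex.piπ F (equivShrink _ f)), ?_⟩
    have := hg (equivShrink _ f)
    rw [Equiv.symm_apply_apply] at this
    refine this.symm.trans ?_
    rw [hS, Preadditive.sum_comp, Preadditive.comp_sum, ← Finset.sum_coe_sort]
    refine Finset.sum_congr rfl fun s _ => ?_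
    rw [← Category.assoc α, hp, Category.assoc]
  refine ⟨S, inferInstance, α, fun Y hY g => ?_⟩
  obtain ⟨B, S, φ, ψ, rfl⟩ := hc.exists_eq_sum ha g
  choose γ hγ using fun s => key (φ s)
  refine ⟨∑ s ∈ S, γ s ≫ ψ s, ?_⟩
  rw [Preadditive.comp_sum]
  refine Finset.sum_congr rfl fun s _ => ?_
  rw [← Category.assoc, ← hγ]

end

lemma eq_zero_of_single_of_isLE (M : ModuleCat.{u} R) [Module.Finite R M] [Module.Projective R M]
    {a : ℤ} {Y : DerivedCategory (ModuleCat.{u} R)} [Y.IsLE (a - 1)]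
    (f : (singleFunctor (ModuleCat.{u} R) a).obj M ⟶ Y) : f = 0 := by
  obtain ⟨K, hK, ⟨e⟩⟩ := exists_iso_Q_obj_of_isLE Y (a - 1)
  have := (CochainComplex.isPerfectComplex_single M a).isKProjective
  let e' := (singleFunctorIsoCompQ (ModuleCat.{u} R) a).app M
  obtain ⟨g, hg⟩ : ∃ g : (CochainComplex.singleFunctor (ModuleCat.{u} R) a).obj M ⟶ K,
      Q.map g = e'.inv ≫ f ≫ e.hom := exists_Q_map_eq_of_isKProjective _
  have hg₀ : g = 0 := by
    ext1 i
    by_cases hi : i = a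
    · exact (K.isZero_of_isStrictlyLE (a - 1) i (by omega)).eq_of_tgt _ _
    · exact (HomologicalComplex.isZero_single_obj_X _ _ _ _ hi).eq_of_src _ _
  rw [← cancel_mono e.hom, ← cancel_epi e'.inv, ← hg, hg₀, Functor.map_zero, zero_comp, comp_zero]

lemma eq_zero_of_shift_single_of_isLE (M : ModuleCat.{u} R) [Module.Finite R M]
    [Module.Projective R M] {a : ℤ} {Y : DerivedCategory (ModuleCat.{u} R)} [Y.IsLE a]
    (f : ((singleFunctor (ModuleCat.{u} R) a).obj M)⟦(-1 : ℤ)⟧ ⟶ Y) : f = 0 := by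
  have := TStructure.t.isLE_shift Y a 1 (a - 1)
  have h := eq_zero_of_single_of_isLE (a := a) M
    ((shiftNegShift ((singleFunctor (ModuleCat.{u} R) a).obj M) (1 : ℤ)).inv ≫ f⟦(1 : ℤ)⟧')
  apply (shiftFunctor (DerivedCategory (ModuleCat.{u} R)) (1 : ℤ)).map_injective
  rw [Functor.map_zero, ← cancel_epi (shiftNegShift _ (1 : ℤ)).inv, h, comp_zero]

lemma isPerfect_of_retract_freeSingle {c : DerivedCategory (ModuleCat.{u} R)} {a : ℤ}
    {I : Type u} [Finite I] (r : Retract c (freeSingle R I a)) : IsPerfect c := by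
  have := isLE_of_retract r a
  have := isGE_of_retract r a
  obtain ⟨M, ⟨e⟩⟩ := exists_iso_singleFunctor_obj_of_isGE_of_isLE c a
  obtain ⟨i, hi⟩ := (singleFunctor (ModuleCat.{u} R) a).map_surjective (e.inv ≫ r.i)
  obtain ⟨p, hp⟩ := (singleFunctor (ModuleCat.{u} R) a).map_surjective (r.r ≫ e.hom)
  have h : i ≫ p = 𝟙 M := (singleFunctor (ModuleCat.{u} R) a).map_injective (by simp [hi, hp])
  have h' (x : M) : p (i x) = x := ConcreteCategory.congr_hom h x
  have : Module.Finite R M := Module.Finite.of_surjective p.hom fun x => ⟨i x, h' x⟩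
  have : Module.Projective R M := Module.Projective.of_split i.hom p.hom (LinearMap.ext h')
  exact (isPerfect_single M a).of_iso e.symm

lemma IsSigmaCompact.isPerfect_of_isLE (n : ℕ) {c : DerivedCategory (ModuleCat.{u} R)}
    (hc : IsSigmaCompact c) {a : ℤ} [c.IsLE (a + n)]
    (ha : ∀ (Y : DerivedCategory (ModuleCat.{u} R)), Y.IsLE (a - 1) → ∀ f : c ⟶ Y, f = 0) :
    IsPerfect c := by
  obtain ⟨I, _, α, hα⟩ := hc.exists_hom_freeSingle (b := a + n) ha
  induction n generalizing c a I with
  | zero =>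
    obtain ⟨γ, hγ⟩ := hα c (by simpa using ‹c.IsLE (a + (0 : ℕ))›) (𝟙 c)
    exact isPerfect_of_retract_freeSingle ⟨α, γ, hγ.symm⟩
  | succ n ih =>
    obtain ⟨c', f, h, hT⟩ := distinguished_cocone_triangle₁ α
    have hT' := inv_rot_of_distTriang _ hT
    have hP := (isPerfect_single (ModuleCat.of R (I → R)) a).shift (-1)
    have hc' : IsSigmaCompact c' := IsSigmaCompact.of_distTriang hT' hP.isSigmaCompact hc
    have : ((freeSingle R I a)⟦(-1 : ℤ)⟧).IsLE (a + 1) :=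
      TStructure.t.isLE_shift _ a (-1) (a + 1)
    have h₁ : ((freeSingle R I a)⟦(-1 : ℤ)⟧).IsLE (a + 1 + n) :=
      TStructure.t.isLE_of_le _ (a + 1) _ (by omega)
    have h₃ : c.IsLE (a + 1 + n) :=
      TStructure.t.isLE_of_le c (a + (n + 1 : ℕ)) _ (by push_cast; omega)
    have h₂ := TStructure.t.isLE₂ _ hT' (a + 1 + n) h₁ h₃
    have : c'.IsLE (a + 1 + n) := h₂
    have ha' (Y : DerivedCategory (ModuleCat.{u} R)) (hY : Y.IsLE (a + 1 - 1)) (g : c' ⟶ Y) :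
        g = 0 := by
      rw [add_sub_cancel_right] at hY
      obtain ⟨k, rfl⟩ : ∃ k : c ⟶ Y, g = f ≫ k := Triangle.yoneda_exact₂ _ hT' g
        (eq_zero_of_shift_single_of_isLE (a := a) (ModuleCat.of R (I → R)) _)
      obtain ⟨γ, rfl⟩ := hα Y hY k
      have hfα : f ≫ α = 0 := comp_distTriang_mor_zero₁₂ _ hT
      rw [← Category.assoc, hfα, zero_comp]
    obtain ⟨I', _, α', hα'⟩ := hc'.exists_hom_freeSingle (b := a + 1 + n) ha'
    exact IsPerfect.of_distTriang hT' hP (ih hc' ha' I' inferInstance α' hα')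

end DerivedCategory

/-- An object of the unbounded derived category `D(R)` is compact (i.e. for every small
family `t` of objects the canonical map `⊕_j Hom(c, t j) → Hom(c, ∐ t)` is bijective) if and
only if it is isomorphic in `D(R)` to a bounded cochain complex of finitely generated
projective left `R`-modules. -/
theorem isCompact_iff_iso_bounded_complex_of_fg_projectives
    (c : DerivedCategory (ModuleCat.{u} R)) :
    (∀ (J : Type u) (_ : DecidableEq J) (t : J → DerivedCategory (ModuleCat.{u} R))
      (_ : HasCoproduct t), Function.Bijective (coproductComparison c t)) ↔
    ∃ Z : CochainComplex (ModuleCat.{u} R) ℤ,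
      (∃ a b : ℤ, ∀ j : ℤ, (j < a ∨ b < j) → IsZero (Z.X j)) ∧
      (∀ j : ℤ, Module.Finite R (Z.X j)) ∧ (∀ j : ℤ, Module.Projective R (Z.X j)) ∧
      Nonempty (c ≅ DerivedCategory.Q.obj Z) := by
  constructor
  · intro h
    have hc := DerivedCategory.isSigmaCompact_of_bijective h
    obtain ⟨b, hb⟩ := hc.exists_isLE
    obtain ⟨a, ha⟩ := hc.exists_hom_eq_zero
    have : c.IsLE (a + (b - a).toNat) :=
      DerivedCategory.TStructure.t.isLE_of_le c b _ (by omega)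
    obtain ⟨Z, hZ, e⟩ := hc.isPerfect_of_isLE (b - a).toNat ha
    exact ⟨Z, hZ.bounded, hZ.finite, hZ.projective, e⟩
  · rintro ⟨Z, hb, hf, hp, e⟩ J _ t _
    exact DerivedCategory.IsSigmaCompact.bijective
      (DerivedCategory.IsPerfect.isSigmaCompact ⟨Z, ⟨hb, hf, hp⟩, e⟩) J t
end
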